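/- For every δ > 0 there exists N(δ) such that the following holds for every n ≥ N(δ). Let t be an integer with δn ≤ t ≤ (2n−6)/9 + 1, set N = ex(n,(t+1)K3) + 2, let χ : E(K_n) → {1,…,N} be a surjective edge-coloring admitting no rainbow copy of (t+2)K3, let H ⊆ K_n be a representative graph of χ, and let (T, M, I) be a maximal tiling triple of H with ideal partition (T1, T2, T3, T4) satisfying |T1| ∈ [t−1, t+1], |M| ∈ ((n−3(t+1))/2 − √(2n)/2, (n−3(t+1))/2], and |I| < √(2n). Let V' denote the set of all non-critical vertices of the triangles of T1. Then the subgraph of H induced by V(M) ∪ V' is bipartite. -/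

import Mathlib

open Finset

/-- `H` contains `k` pairwise vertex-disjoint triangles. -/
def HasKDisjointTriangles {n : ℕ} (H : SimpleGraph (Fin n)) (k : ℕ) : Prop :=
  ∃ T : Finset (Finset (Fin n)), T.card = k ∧ (∀ s ∈ T, H.IsNClique 3 s) ∧
    (T : Set (Finset (Fin n))).Pairwise fun s₁ s₂ => Disjoint s₁ s₂

/-- Under the edge-coloring `χ`, the graph `H` contains a rainbow copy of `k`
pairwise vertex-disjoint triangles. -/
def HasRainbowKTriangles {n : ℕ} (H : SimpleGraph (Fin n)) (χ : Sym2 (Fin n) → ℕ)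
    (k : ℕ) : Prop :=
  ∃ T : Finset (Finset (Fin n)), T.card = k ∧ (∀ s ∈ T, H.IsNClique 3 s) ∧
    ((T : Set (Finset (Fin n))).Pairwise fun s₁ s₂ => Disjoint s₁ s₂) ∧
    Set.InjOn χ {e : Sym2 (Fin n) | ¬ e.IsDiag ∧ ∃ s ∈ T, ∀ x ∈ e, x ∈ s}

/-- `χ` is a surjective edge-coloring of `K_n` with colors `{1, …, N}`. -/
def IsSurjColoring (n N : ℕ) (χ : Sym2 (Fin n) → ℕ) : Prop :=
  (∀ e : Sym2 (Fin n), ¬ e.IsDiag → χ e ∈ Finset.Icc 1 N) ∧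
  (∀ c ∈ Finset.Icc 1 N, ∃ e : Sym2 (Fin n), ¬ e.IsDiag ∧ χ e = c)

/-- `ex(n, kK₃)`: the maximum number of edges of an `n`-vertex graph containing no `k`
pairwise vertex-disjoint triangles. -/
noncomputable def exTriangles (n k : ℕ) : ℕ :=
  sSup {m : ℕ | ∃ H : SimpleGraph (Fin n), ¬ HasKDisjointTriangles H k ∧
    H.edgeSet.ncard = m}

/-- `H` is a representative graph of the `N`-coloring `χ`: it is rainbow and has
exactly `N` edges. -/
def IsRepGraph {n : ℕ} (χ : Sym2 (Fin n) → ℕ) (N : ℕ) (H : SimpleGraph (Fin n)) : Prop :=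
  H.edgeSet.ncard = N ∧ Set.InjOn χ H.edgeSet

/-- The edge `e` (a set of two vertices) sees the vertex `w` of the triangle `s`:
`w ∈ s` and both endpoints of `e` are adjacent to `w` in `H`. -/
def seesAt {n : ℕ} (H : SimpleGraph (Fin n)) (e s : Finset (Fin n)) (w : Fin n) : Prop :=
  w ∈ s ∧ ∀ u ∈ e, H.Adj u w

/-- The edge `e` sees the triangle `s`. -/
def sees {n : ℕ} (H : SimpleGraph (Fin n)) (e s : Finset (Fin n)) : Prop :=
  ∃ w, seesAt H e s w

/-- The vertex `p` sees the triangle `s`: `p` is adjacent to two distinct vertices of `s`. -/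
def vertexSees {n : ℕ} (H : SimpleGraph (Fin n)) (p : Fin n) (s : Finset (Fin n)) : Prop :=
  ∃ w₁ ∈ s, ∃ w₂ ∈ s, w₁ ≠ w₂ ∧ H.Adj p w₁ ∧ H.Adj p w₂

/-- The triangle `u` sees the triangle `s`: some edge of `u` sees `s`. -/
def triSees {n : ℕ} (H : SimpleGraph (Fin n)) (u s : Finset (Fin n)) : Prop :=
  ∃ a ∈ u, ∃ b ∈ u, a ≠ b ∧ sees H {a, b} s

/-- `(T, M, I)` is a tiling triple of `H`: `T` is a family of pairwise vertex-disjoint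
triangles, `M` is a matching, `I` is an independent set, and `V(T), V(M), I` partition
the vertex set. -/
def IsTilingTriple {n : ℕ} (H : SimpleGraph (Fin n)) (T M : Finset (Finset (Fin n)))
    (I : Finset (Fin n)) : Prop :=
  (∀ s ∈ T, H.IsNClique 3 s) ∧ (∀ e ∈ M, H.IsNClique 2 e) ∧
  (∀ x ∈ I, ∀ y ∈ I, ¬ H.Adj x y) ∧
  (((T ∪ M : Finset (Finset (Fin n))) : Set (Finset (Fin n))).Pairwise
    fun s₁ s₂ => Disjoint s₁ s₂) ∧
  Disjoint ((T ∪ M).biUnion id) I ∧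
  (T ∪ M).biUnion id ∪ I = Finset.univ

/-- `(T, M, I)` is a tiling triple of `H` with `(|T|, |M|)` lexicographically maximal. -/
def IsMaxTilingTriple {n : ℕ} (H : SimpleGraph (Fin n)) (T M : Finset (Finset (Fin n)))
    (I : Finset (Fin n)) : Prop :=
  IsTilingTriple H T M I ∧
  ∀ T' M' : Finset (Finset (Fin n)), ∀ I' : Finset (Fin n), IsTilingTriple H T' M' I' →
    T'.card < T.card ∨ (T'.card = T.card ∧ M'.card ≤ M.card)

/-- The number of edges of `H` between the (disjoint) vertex sets `A` and `B`. -/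
noncomputable def eBetween {n : ℕ} (H : SimpleGraph (Fin n)) (A B : Set (Fin n)) : ℕ :=
  Set.ncard {p : Fin n × Fin n | p.1 ∈ A ∧ p.2 ∈ B ∧ H.Adj p.1 p.2}

/-- `(T₁, T₂, T₃, T₄)` is an ideal partition of `T` for the tiling triple `(T, M, I)`:
`T₁` consists of the triangles of `T` seen by at least two edges of `M`; `T₂` consists of
the triangles of `T ∖ T₁` seen by at least two other members of `T`, or by one edge of
`M` and at least one vertex of `I`; and `(T₃, T₄)` arises from the greedy removal process
on `D = T ∖ (T₁ ∪ T₂)`: while some triangle of `D` sends at most `8(|D|−1)` edges to the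
other triangles of `D`, it is removed (the removed triangles, in order, form `T₃`),
and `T₄` is the final set `D`, in which every triangle sends more than `8(|T₄|−1)`
edges to the other triangles of `T₄`. -/
def IsIdealPartition {n : ℕ} (H : SimpleGraph (Fin n)) (T M : Finset (Finset (Fin n)))
    (I : Finset (Fin n)) (T₁ T₂ T₃ T₄ : Finset (Finset (Fin n))) : Prop :=
  T₁ ∪ T₂ ∪ T₃ ∪ T₄ = T ∧
  Disjoint T₁ T₂ ∧ Disjoint T₁ T₃ ∧ Disjoint T₁ T₄ ∧
  Disjoint T₂ T₃ ∧ Disjoint T₂ T₄ ∧ Disjoint T₃ T₄ ∧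
  (∀ s, s ∈ T₁ ↔ s ∈ T ∧ ∃ e₁ ∈ M, ∃ e₂ ∈ M, e₁ ≠ e₂ ∧ sees H e₁ s ∧ sees H e₂ s) ∧
  (∀ s, s ∈ T₂ ↔ s ∈ T ∧ s ∉ T₁ ∧
    ((∃ s₁ ∈ T, ∃ s₂ ∈ T, s₁ ≠ s₂ ∧ s₁ ≠ s ∧ s₂ ≠ s ∧ triSees H s₁ s ∧ triSees H s₂ s) ∨
      ((∃ e ∈ M, sees H e s) ∧ (∃ p ∈ I, vertexSees H p s)))) ∧
  (∃ k : ℕ, ∃ g : Fin k → Finset (Fin n), Function.Injective g ∧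
    Finset.image g Finset.univ = T₃ ∧
    ∀ j : Fin k,
      eBetween H (↑(g j))
          (↑((((Finset.univ.filter fun i : Fin k => j < i).image g) ∪ T₄).biUnion id))
        ≤ 8 * (k - (j : ℕ) + T₄.card - 1)) ∧
  (∀ s ∈ T₄, 8 * (T₄.card - 1) < eBetween H (↑s) (↑((T₄.erase s).biUnion id)))

/-- `x` is the critical vertex of the triangle `s` (with respect to the matching `M`):
some edge of `M` sees `x` of `s`, and every edge of `M` seeing `s` sees only `x` of `s`. -/
def IsCriticalVertex {n : ℕ} (H : SimpleGraph (Fin n)) (M : Finset (Finset (Fin n)))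
    (s : Finset (Fin n)) (x : Fin n) : Prop :=
  x ∈ s ∧ (∃ e ∈ M, seesAt H e s x) ∧ ∀ e ∈ M, ∀ w, seesAt H e s w → w = x

/-- The set of non-critical vertices of the triangles in `T₁`. -/
def nonCriticalVerts {n : ℕ} (H : SimpleGraph (Fin n)) (M T₁ : Finset (Finset (Fin n))) :
    Set (Fin n) :=
  {w | ∃ s ∈ T₁, ∃ x, IsCriticalVertex H M s x ∧ w ∈ s ∧ w ≠ x}

theorem hasKDisjointTriangles_of_indexed {n : ℕ} {H : SimpleGraph (Fin n)} {ι : Type*}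
    [Fintype ι] (f : ι → Finset (Fin n)) (hf : ∀ i, H.IsNClique 3 (f i))
    (hd : ∀ i j, i ≠ j → Disjoint (f i) (f j)) {k : ℕ} (hk : k ≤ Fintype.card ι) :
    HasKDisjointTriangles H k := by
  classical
  have hinj : Function.Injective f := by
    intro i j hij
    by_contra hne
    have h := hd i j hne
    rw [hij, disjoint_self] at h
    have h3 := (hf j).card_eq
    rw [h] at h3
    simp at h3
  have hcard : k ≤ (univ.image f).card := by
    rwa [card_image_of_injective _ hinj, card_univ]
  obtain ⟨U, hU, hUk⟩ := exists_subset_card_eq hcard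
  refine ⟨U, hUk, ?_, ?_⟩
  · intro s hs
    obtain ⟨i, -, rfl⟩ := mem_image.1 (hU hs)
    exact hf i
  · intro s hs s' hs' hne
    obtain ⟨i, -, rfl⟩ := mem_image.1 (hU hs)
    obtain ⟨j, -, rfl⟩ := mem_image.1 (hU hs')
    exact hd i j fun h => hne (h ▸ rfl)

/-- The members of `M` that see the vertex `c s` of `s`. -/
noncomputable def seers {n : ℕ} (H : SimpleGraph (Fin n)) (M : Finset (Finset (Fin n)))
    (c : Finset (Fin n) → Fin n) (s : Finset (Fin n)) : Finset (Finset (Fin n)) := by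
  classical exact M.filter fun e => seesAt H e s (c s)

theorem mem_seers {n : ℕ} {H : SimpleGraph (Fin n)} {M : Finset (Finset (Fin n))}
    {c : Finset (Fin n) → Fin n} {s e : Finset (Fin n)} :
    e ∈ seers H M c s ↔ e ∈ M ∧ seesAt H e s (c s) := by
  simp [seers]

/-- A family `T` of disjoint triangles and a matching `M` disjoint from it, such that `H` has
no `|T| + 1` disjoint triangles. -/
structure IsOptimalTiling {n : ℕ} (H : SimpleGraph (Fin n)) (T M : Finset (Finset (Fin n))) :
    Prop where
  tri : ∀ s ∈ T, H.IsNClique 3 s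
  edge : ∀ e ∈ M, H.IsNClique 2 e
  disj : ((T ∪ M : Finset (Finset (Fin n))) : Set (Finset (Fin n))).Pairwise
    fun s₁ s₂ => Disjoint s₁ s₂
  opt : ¬ HasKDisjointTriangles H (T.card + 1)

namespace IsOptimalTiling

variable {n : ℕ} {H : SimpleGraph (Fin n)} {T M : Finset (Finset (Fin n))}

theorem eq_of_mem (h : IsOptimalTiling H T M) {s s' : Finset (Fin n)} (hs : s ∈ T ∪ M)
    (hs' : s' ∈ T ∪ M) {v : Fin n} (hv : v ∈ s) (hv' : v ∈ s') : s = s' := by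
  by_contra hne
  exact disjoint_left.1 (h.disj hs hs' hne) hv hv'

theorem disjoint_families (h : IsOptimalTiling H T M) : Disjoint T M := by
  rw [disjoint_left]
  intro s hs hs'
  have h1 := (h.tri s hs).card_eq
  have h2 := (h.edge s hs').card_eq
  omega

theorem exchange (h : IsOptimalTiling H T M) (c : Finset (Fin n) → Fin n)
    {F τ J μ : Finset (Finset (Fin n))}
    (hF : ∀ f ∈ F, H.IsNClique 3 f) (hFd : ∀ f ∈ F, ∀ g ∈ F, f ≠ g → Disjoint f g)
    (hτT : τ ⊆ T) (hJ : J ⊆ τ) (hcJ : ∀ s ∈ J, ∀ f ∈ F, c s ∉ f)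
    (hτ : ∀ s ∈ T, s ∉ τ → ∀ f ∈ F, Disjoint s f)
    (hμ : ∀ e ∈ M, e ∉ μ → ∀ f ∈ F, Disjoint e f)
    (hsee : ∀ s ∈ J, J.card + μ.card ≤ (seers H M c s).card) :
    F.card + J.card ≤ τ.card := by
  classical
  obtain ⟨g, hginj, hg⟩ : ∃ g : J → Finset (Fin n), Function.Injective g ∧
      ∀ s, g s ∈ seers H M c s.1 \ μ := by
    rw [← Finset.all_card_le_biUnion_card_iff_exists_injective]
    intro S
    rcases S.eq_empty_or_nonempty with rfl | ⟨s, hs⟩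
    · simp
    · have h1 : S.card ≤ J.card := by
        simpa using card_le_univ S
      have h2 := hsee s.1 s.2
      have h3 := le_card_sdiff μ (seers H M c s.1)
      have h4 : (seers H M c s.1 \ μ).card ≤
          (S.biUnion fun s => seers H M c s.1 \ μ).card :=
        card_le_card (subset_biUnion_of_mem (fun s : J => seers H M c s.1 \ μ) hs)
      omega
  by_contra hlt
  apply h.opt
  have hgM : ∀ s, g s ∈ M ∧ seesAt H (g s) s.1 (c s.1) ∧ g s ∉ μ := by
    intro s
    have := hg s
    rw [mem_sdiff, mem_seers] at this
    tauto
  have hcs : ∀ s : J, c s.1 ∈ s.1 := fun s => (hgM s).2.1.1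
  let φ : ({s // s ∈ T \ τ} ⊕ {f // f ∈ F}) ⊕ J → Finset (Fin n) :=
    Sum.elim (Sum.elim (fun s => s.1) fun f => f.1) fun s => insert (c s.1) (g s)
  have d12 : ∀ (s : {s // s ∈ T \ τ}) (f : {f // f ∈ F}), Disjoint s.1 f.1 := fun s f =>
    hτ s.1 (mem_sdiff.1 s.2).1 (mem_sdiff.1 s.2).2 f.1 f.2
  have hJT : ∀ s : J, s.1 ∈ T := fun s => hτT (hJ s.2)
  have d13 : ∀ (s : {s // s ∈ T \ τ}) (j : J), Disjoint s.1 (insert (c j.1) (g j)) := by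
    intro s j
    have hsT := (mem_sdiff.1 s.2).1
    have hsτ := (mem_sdiff.1 s.2).2
    rw [disjoint_insert_right]
    refine ⟨fun hc => hsτ ?_, ?_⟩
    · have := h.eq_of_mem (mem_union_left _ hsT) (mem_union_left _ (hJT j)) hc (hcs j)
      exact this ▸ hJ j.2
    · refine h.disj (mem_union_left _ hsT) (mem_union_right _ (hgM j).1) fun he => ?_
      exact disjoint_left.1 h.disjoint_families hsT (he ▸ (hgM j).1)
  have d23 : ∀ (f : {f // f ∈ F}) (j : J), Disjoint f.1 (insert (c j.1) (g j)) := by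
    intro f j
    rw [disjoint_insert_right]
    exact ⟨hcJ j.1 j.2 f.1 f.2, (hμ (g j) (hgM j).1 (hgM j).2.2 f.1 f.2).symm⟩
  have d33 : ∀ i j : J, i ≠ j → Disjoint (insert (c i.1) (g i)) (insert (c j.1) (g j)) := by
    intro i j hij
    rw [disjoint_left]
    intro v hv hv'
    rw [mem_insert] at hv hv'
    have hne : i.1 ≠ j.1 := fun h => hij (Subtype.ext h)
    rcases hv with rfl | hv <;> rcases hv' with hv' | hv'
    · exact hne (h.eq_of_mem (mem_union_left _ (hJT i)) (mem_union_left _ (hJT j)) (hcs i)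
        (hv' ▸ hcs j))
    · have := h.eq_of_mem (mem_union_left _ (hJT i)) (mem_union_right _ (hgM j).1) (hcs i) hv'
      exact disjoint_left.1 h.disjoint_families (hJT i) (this ▸ (hgM j).1)
    · have := h.eq_of_mem (mem_union_left _ (hJT j)) (mem_union_right _ (hgM i).1) (hcs j)
        (hv' ▸ hv)
      exact disjoint_left.1 h.disjoint_families (hJT j) (this ▸ (hgM i).1)
    · exact hij (hginj (h.eq_of_mem (mem_union_right _ (hgM i).1)
        (mem_union_right _ (hgM j).1) hv hv'))
  refine hasKDisjointTriangles_of_indexed φ ?_ ?_ ?_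
  · rintro ((s | f) | j)
    · exact h.tri s.1 (mem_sdiff.1 s.2).1
    · exact hF f.1 f.2
    · exact (h.edge _ (hgM j).1).insert fun b hb => ((hgM j).2.1.2 b hb).symm
  · rintro ((s | f) | j) ((s' | f') | j') hne
    · refine h.disj (mem_union_left _ (mem_sdiff.1 s.2).1)
        (mem_union_left _ (mem_sdiff.1 s'.2).1) fun he => hne ?_
      rw [Subtype.ext he]
    · exact d12 s f'
    · exact d13 s j'
    · exact (d12 s' f).symm
    · refine hFd f.1 f.2 f'.1 f'.2 fun he => hne ?_
      rw [Subtype.ext he]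
    · exact d23 f j'
    · exact (d13 s' j).symm
    · exact (d23 f' j).symm
    · exact d33 j j' fun he => hne (he ▸ rfl)
  · have h1 := card_sdiff_of_subset hτT
    have h2 := card_le_card hτT
    simp only [Fintype.card_sum, Fintype.card_coe]
    omega

end IsOptimalTiling

/-- A triangle `s` of `T₁` without its vertex `c s`; other sets are left unchanged. -/
noncomputable def core {n : ℕ} (T₁ : Finset (Finset (Fin n))) (c : Finset (Fin n) → Fin n)
    (s : Finset (Fin n)) : Finset (Fin n) := by
  classical exact if s ∈ T₁ then s.erase (c s) else s

/-- The union of the edges of `M` and of the triangles of `T₁` without their vertices `c s`. -/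
noncomputable def coreVerts {n : ℕ} (M T₁ : Finset (Finset (Fin n)))
    (c : Finset (Fin n) → Fin n) : Finset (Fin n) :=
  (T₁ ∪ M).biUnion (core T₁ c)

/-- An optimal tiling with leftover independent set `I`, in which every triangle `s` of `T₁`
has a vertex `c s` seen by at least two edges of `M`. -/
structure IsCriticalTiling {n : ℕ} (H : SimpleGraph (Fin n)) (T M : Finset (Finset (Fin n)))
    (I : Finset (Fin n)) (T₁ : Finset (Finset (Fin n))) (c : Finset (Fin n) → Fin n) : Prop
    extends IsOptimalTiling H T M where
  indep : ∀ x ∈ I, ∀ y ∈ I, ¬ H.Adj x y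
  disjI : Disjoint ((T ∪ M).biUnion id) I
  cover : (T ∪ M).biUnion id ∪ I = univ
  sub : T₁ ⊆ T
  crit_mem : ∀ s ∈ T₁, c s ∈ s
  two_le : ∀ s ∈ T₁, 2 ≤ (seers H M c s).card

namespace IsCriticalTiling

variable {n : ℕ} {H : SimpleGraph (Fin n)} {T M : Finset (Finset (Fin n))} {I : Finset (Fin n)}
  {T₁ : Finset (Finset (Fin n))} {c : Finset (Fin n) → Fin n}

theorem core_of_mem {s : Finset (Fin n)} (hs : s ∈ T₁) : core T₁ c s = s.erase (c s) := by
  simp [core, hs]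

theorem core_subset (s : Finset (Fin n)) : core T₁ c s ⊆ s := by
  classical
  unfold core
  split_ifs
  · exact erase_subset _ _
  · exact subset_rfl

theorem notMem_T₁ (h : IsCriticalTiling H T M I T₁ c) {e : Finset (Fin n)} (he : e ∈ M) :
    e ∉ T₁ := fun h' => disjoint_left.1 h.disjoint_families (h.sub h') he

theorem core_of_mem_M (h : IsCriticalTiling H T M I T₁ c) {e : Finset (Fin n)} (he : e ∈ M) :
    core T₁ c e = e := by
  simp [core, h.notMem_T₁ he]

theorem mem_union_of_mem (h : IsCriticalTiling H T M I T₁ c) {s : Finset (Fin n)}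
    (hs : s ∈ T₁ ∪ M) : s ∈ T ∪ M :=
  union_subset_union h.sub subset_rfl hs

theorem isNClique_core (h : IsCriticalTiling H T M I T₁ c) {s : Finset (Fin n)}
    (hs : s ∈ T₁ ∪ M) : H.IsNClique 2 (core T₁ c s) := by
  rcases mem_union.1 hs with hs | hs
  · rw [core_of_mem hs]
    have h3 := h.tri s (h.sub hs)
    refine ⟨h3.isClique.subset (by simp), ?_⟩
    rw [card_erase_of_mem (h.crit_mem s hs), h3.card_eq]
  · rw [h.core_of_mem_M hs]
    exact h.edge s hs

theorem crit_notMem_core (h : IsCriticalTiling H T M I T₁ c) {s s' : Finset (Fin n)}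
    (hs : s ∈ T₁) (hs' : s' ∈ T₁ ∪ M) : c s ∉ core T₁ c s' := by
  intro hc
  have := h.eq_of_mem (h.mem_union_of_mem (mem_union_left _ hs)) (h.mem_union_of_mem hs')
    (h.crit_mem s hs) (core_subset _ hc)
  subst this
  rw [core_of_mem hs] at hc
  simp at hc

theorem eq_of_mem_core (h : IsCriticalTiling H T M I T₁ c) {s s' : Finset (Fin n)}
    (hs : s ∈ T₁ ∪ M) (hs' : s' ∈ T₁ ∪ M) {v : Fin n} (hv : v ∈ core T₁ c s)
    (hv' : v ∈ core T₁ c s') : s = s' :=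
  h.eq_of_mem (h.mem_union_of_mem hs) (h.mem_union_of_mem hs') (core_subset _ hv)
    (core_subset _ hv')

theorem notMem_I (h : IsCriticalTiling H T M I T₁ c) {s : Finset (Fin n)} (hs : s ∈ T ∪ M)
    {v : Fin n} (hv : v ∈ s) : v ∉ I := by
  refine fun hI => disjoint_left.1 h.disjI ?_ hI
  exact mem_biUnion.2 ⟨s, hs, hv⟩

theorem augment (h : IsCriticalTiling H T M I T₁ c) {F S K D : Finset (Finset (Fin n))}
    (hF : ∀ f ∈ F, H.IsNClique 3 f) (hFd : ∀ f ∈ F, ∀ g ∈ F, f ≠ g → Disjoint f g)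
    (hS : S ⊆ T₁ ∪ M) (hK : K ⊆ T₁) (hD : D ⊆ T \ T₁)
    (hsub : ∀ f ∈ F, f ⊆ S.biUnion (core T₁ c) ∪ I ∪ K.image c ∪ D.biUnion id)
    (hsee : ∀ s ∈ S, s ∈ T₁ → s ∉ K → (S \ K).card ≤ (seers H M c s).card) :
    F.card ≤ K.card + D.card := by
  classical
  have key : ∀ s ∈ T ∪ M, ∀ v ∈ s, ∀ f ∈ F, v ∈ f →
      (s ∈ S ∧ v ∈ core T₁ c s) ∨ s ∈ K ∨ s ∈ D := by
    intro s hs v hv f hf hvf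
    have := hsub f hf hvf
    simp only [mem_union, mem_biUnion, mem_image, id] at this
    rcases this with ((⟨s', hs', hv'⟩ | hI) | ⟨k, hk, rfl⟩) | ⟨d, hd, hv'⟩
    · have := h.eq_of_mem hs (h.mem_union_of_mem (hS hs')) hv (core_subset _ hv')
      subst this
      exact Or.inl ⟨hs', hv'⟩
    · exact absurd hI (h.notMem_I hs hv)
    · have := h.eq_of_mem hs (mem_union_left _ (h.sub (hK hk))) hv (h.crit_mem k (hK hk))
      exact Or.inr (Or.inl (this ▸ hk))
    · have := h.eq_of_mem hs (mem_union_left _ (mem_sdiff.1 (hD hd)).1) hv hv'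
      exact Or.inr (Or.inr (this ▸ hd))
  have hSK : (S ∩ T₁) \ K ∪ S ∩ M ⊆ S \ K := by
    intro s hs
    simp only [mem_union, mem_sdiff, mem_inter] at hs ⊢
    rcases hs with hs | hs
    · tauto
    · exact ⟨hs.1, fun hk => h.notMem_T₁ hs.2 (hK hk)⟩
  have hSK' : ((S ∩ T₁) \ K).card + (S ∩ M).card ≤ (S \ K).card := by
    rw [← card_union_of_disjoint]
    · exact card_le_card hSK
    · rw [disjoint_left]
      intro s hs hs'
      simp only [mem_sdiff, mem_inter] at hs hs'
      exact h.notMem_T₁ hs'.2 hs.1.2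
  have := h.exchange c (F := F) (τ := ((S ∩ T₁) \ K) ∪ (K ∪ D)) (J := (S ∩ T₁) \ K)
    (μ := S ∩ M) hF hFd ?_ subset_union_left ?_ ?_ ?_ ?_
  · have h1 := card_union_le ((S ∩ T₁) \ K) (K ∪ D)
    have h2 := card_union_le K D
    omega
  · intro s hs
    simp only [mem_union, mem_sdiff, mem_inter] at hs
    rcases hs with hs | hs | hs
    · exact h.sub hs.1.2
    · exact h.sub (hK hs)
    · exact (mem_sdiff.1 (hD hs)).1
  · intro s hs f hf hcf
    simp only [mem_sdiff, mem_inter] at hs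
    rcases key s (mem_union_left _ (h.sub hs.1.2)) (c s) (h.crit_mem s hs.1.2) f hf hcf with
      h1 | h1 | h1
    · exact h.crit_notMem_core hs.1.2 (mem_union_left _ hs.1.2) h1.2
    · exact hs.2 h1
    · exact (mem_sdiff.1 (hD h1)).2 hs.1.2
  · intro s hs hsτ f hf
    rw [disjoint_left]
    intro v hv hvf
    apply hsτ
    simp only [mem_union, mem_sdiff, mem_inter]
    rcases key s (mem_union_left _ hs) v hv f hf hvf with h1 | h1 | h1
    · by_cases hk : s ∈ K
      · exact Or.inr (Or.inl hk)
      · rcases mem_union.1 (hS h1.1) with h2 | h2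
        · exact Or.inl ⟨⟨h1.1, h2⟩, hk⟩
        · exact absurd h2 (disjoint_left.1 h.disjoint_families hs)
    · exact Or.inr (Or.inl h1)
    · exact Or.inr (Or.inr h1)
  · intro e he heμ f hf
    rw [disjoint_left]
    intro v hv hvf
    rcases key e (mem_union_right _ he) v hv f hf hvf with h1 | h1 | h1
    · exact heμ (mem_inter.2 ⟨h1.1, he⟩)
    · exact h.notMem_T₁ he (hK h1)
    · exact disjoint_left.1 h.disjoint_families (mem_sdiff.1 (hD h1)).1 he
  · intro s hs
    simp only [mem_sdiff, mem_inter] at hs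
    exact hSK'.trans (hsee s hs.1.1 hs.1.2 hs.2)

/-- A triangle inside the union of few cores forces one of the touched triangles of `T₁` to be
seen by few edges of `M`. -/
theorem exists_card_seers_lt (h : IsCriticalTiling H T M I T₁ c) {S : Finset (Finset (Fin n))}
    (hS : S ⊆ T₁ ∪ M) {f : Finset (Fin n)} (hf : H.IsNClique 3 f)
    (hsub : f ⊆ S.biUnion (core T₁ c) ∪ I) :
    ∃ s ∈ S, s ∈ T₁ ∧ (seers H M c s).card < S.card := by
  by_contra! hcon
  have := h.augment (F := {f}) (K := ∅) (D := ∅) (S := S) (by simpa) (by simp) hS (by simp)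
    (by simp) (by simpa using hsub) fun s hs hs' _ => by simpa using hcon s hs hs'
  simp at this

theorem not_triangle_of_card_le_two (h : IsCriticalTiling H T M I T₁ c)
    {S : Finset (Finset (Fin n))} (hS : S ⊆ T₁ ∪ M) (hS2 : S.card ≤ 2) {f : Finset (Fin n)}
    (hsub : f ⊆ S.biUnion (core T₁ c) ∪ I) : ¬ H.IsNClique 3 f := by
  intro hf
  obtain ⟨s, -, hs, hlt⟩ := h.exists_card_seers_lt hS hf hsub
  have := h.two_le s hs
  omega

theorem not_triangle_of_subset_M (h : IsCriticalTiling H T M I T₁ c)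
    {S : Finset (Finset (Fin n))} (hS : S ⊆ M) {f : Finset (Fin n)}
    (hsub : f ⊆ S.biUnion id) : ¬ H.IsNClique 3 f := by
  intro hf
  have hb : S.biUnion (core T₁ c) = S.biUnion id :=
    biUnion_congr rfl fun s hs => h.core_of_mem_M (hS hs)
  obtain ⟨s, hs, hs', -⟩ := h.exists_card_seers_lt (hS.trans subset_union_right) hf
    (by rw [hb]; exact hsub.trans subset_union_left)
  exact h.notMem_T₁ (hS hs) hs'

end IsCriticalTiling

/-- The number of neighbours of `u` in `Y`. -/
noncomputable def nbrCount {n : ℕ} (H : SimpleGraph (Fin n)) (u : Fin n)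
    (Y : Finset (Fin n)) : ℕ := by
  classical exact (Y.filter fun v => H.Adj u v).card

/-- The number of ordered pairs of adjacent vertices in `X × Y`. -/
noncomputable def adjCount {n : ℕ} (H : SimpleGraph (Fin n)) (X Y : Finset (Fin n)) : ℕ :=
  ∑ u ∈ X, nbrCount H u Y

section Counting

variable {n : ℕ} {H : SimpleGraph (Fin n)}

theorem nbrCount_le_card (u : Fin n) (Y : Finset (Fin n)) : nbrCount H u Y ≤ Y.card := by
  classical
  unfold nbrCount
  exact card_filter_le _ _

theorem nbrCount_biUnion {ι : Type*} {S : Finset ι} {f : ι → Finset (Fin n)}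
    (h : ∀ i ∈ S, ∀ j ∈ S, i ≠ j → Disjoint (f i) (f j)) (u : Fin n) :
    nbrCount H u (S.biUnion f) = ∑ i ∈ S, nbrCount H u (f i) := by
  classical
  unfold nbrCount
  rw [filter_biUnion, card_biUnion]
  exact fun i hi j hj hij => disjoint_filter_filter (h i hi j hj hij)

theorem nbrCount_le_card_sub_one {u v : Fin n} {Y : Finset (Fin n)} (hv : v ∈ Y)
    (hadj : ¬ H.Adj u v) : nbrCount H u Y + 1 ≤ Y.card := by
  classical
  unfold nbrCount
  exact card_lt_card ⟨filter_subset _ _, fun hsub => hadj (mem_filter.1 (hsub hv)).2⟩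

theorem exists_adj_of_nbrCount_pos {u : Fin n} {Y : Finset (Fin n)}
    (h : 0 < nbrCount H u Y) : ∃ v ∈ Y, H.Adj u v := by
  classical
  unfold nbrCount at h
  obtain ⟨v, hv⟩ := card_pos.1 h
  exact ⟨v, (mem_filter.1 hv).1, (mem_filter.1 hv).2⟩

theorem adjCount_comm (X Y : Finset (Fin n)) : adjCount H X Y = adjCount H Y X := by
  classical
  simp only [adjCount, nbrCount, card_filter]
  rw [sum_comm]
  simp only [H.adj_comm]

theorem adjCount_union_left {X Y : Finset (Fin n)} (h : Disjoint X Y) (Z : Finset (Fin n)) :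
    adjCount H (X ∪ Y) Z = adjCount H X Z + adjCount H Y Z := by
  classical
  exact sum_union h

theorem adjCount_union_right {Y Z : Finset (Fin n)} (h : Disjoint Y Z) (X : Finset (Fin n)) :
    adjCount H X (Y ∪ Z) = adjCount H X Y + adjCount H X Z := by
  rw [adjCount_comm, adjCount_union_left h, adjCount_comm, adjCount_comm Z]

theorem adjCount_le_mul {X Y : Finset (Fin n)} {k : ℕ} (h : ∀ u ∈ X, nbrCount H u Y ≤ k) :
    adjCount H X Y ≤ X.card * k := by
  simpa [adjCount] using sum_le_card_nsmul X _ k h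

theorem adjCount_le_card_mul_card (X Y : Finset (Fin n)) :
    adjCount H X Y ≤ X.card * Y.card :=
  adjCount_le_mul fun u _ => nbrCount_le_card u Y

theorem adjCount_self_add_card_le (X : Finset (Fin n)) :
    adjCount H X X + X.card ≤ X.card * X.card := by
  have : ∑ u ∈ X, (nbrCount H u X + 1) ≤ X.card * X.card := by
    simpa using sum_le_card_nsmul X _ X.card
      fun u hu => nbrCount_le_card_sub_one (H := H) hu (H.irrefl)
  rw [sum_add_distrib] at this
  simpa [adjCount] using this

theorem adjCount_self_eq_zero {X : Finset (Fin n)} (h : ∀ x ∈ X, ∀ y ∈ X, ¬ H.Adj x y) :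
    adjCount H X X = 0 := by
  classical
  refine sum_eq_zero fun u hu => ?_
  exact card_eq_zero.2 (filter_eq_empty_iff.2 fun v hv => h u hu v hv)

theorem adjCount_univ : adjCount H univ univ = 2 * H.edgeSet.ncard := by
  classical
  rw [Set.ncard_eq_toFinset_card', ← SimpleGraph.edgeFinset,
    ← H.sum_degrees_eq_twice_card_edges]
  refine sum_congr rfl fun u _ => ?_
  rw [← H.card_neighborFinset_eq_degree, H.neighborFinset_eq_filter]
  unfold nbrCount
  congr

end Counting

theorem ncard_edgeSet_le_exTriangles {n k : ℕ} {H : SimpleGraph (Fin n)}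
    (h : ¬ HasKDisjointTriangles H k) : H.edgeSet.ncard ≤ exTriangles n k := by
  refine le_csSup ⟨(Set.univ : Set (Sym2 (Fin n))).ncard, ?_⟩ ⟨H, h, rfl⟩
  rintro m ⟨K, -, rfl⟩
  exact Set.ncard_le_ncard (Set.subset_univ _)

/-- Joining a clique to a complete bipartite graph gives a lower bound for `exTriangles`. -/
theorem sq_le_two_mul_exTriangles {n t α β : ℕ} (hn : t + α + β = n) :
    n * n ≤ 2 * exTriangles n (t + 1) + t + α * α + β * β := by
  classical
  obtain ⟨A, -, hA⟩ := exists_subset_card_eq (s := (univ : Finset (Fin n))) (n := α)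
    (by simp; omega)
  obtain ⟨B, hBA, hB⟩ := exists_subset_card_eq (s := Aᶜ) (n := β)
    (by rw [card_compl, Fintype.card_fin]; omega)
  have hAB : Disjoint A B := by
    rw [disjoint_left]
    exact fun v hv hv' => (mem_compl.1 (hBA hv')) hv
  set S := (A ∪ B)ᶜ with hSdef
  have hS : S.card = t := by
    rw [hSdef, card_compl, card_union_of_disjoint hAB, Fintype.card_fin]
    omega
  let G : SimpleGraph (Fin n) :=
    { Adj := fun u v => u ≠ v ∧ ¬ (u ∈ A ∧ v ∈ A) ∧ ¬ (u ∈ B ∧ v ∈ B)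
      symm := ⟨fun u v h => ⟨h.1.symm, fun h' => h.2.1 h'.symm, fun h' => h.2.2 h'.symm⟩⟩
      loopless := ⟨fun u h => h.1 rfl⟩ }
  have hfree : ¬ HasKDisjointTriangles G (t + 1) := by
    rintro ⟨U, hU, htri, hdis⟩
    have hex : ∀ s ∈ U, ∃ v ∈ S, v ∈ s := by
      intro s hs
      by_contra! hcon
      have hsAB : s ⊆ A ∪ B := fun v hv => by
        by_contra hv'
        exact hcon v (mem_compl.2 hv') hv
      have h3 := htri s hs
      have hA1 : (s ∩ A).card ≤ 1 := card_le_one.2 fun a ha b hb => by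
        by_contra hne
        have := h3.isClique (mem_inter.1 ha).1 (mem_inter.1 hb).1 hne
        exact this.2.1 ⟨(mem_inter.1 ha).2, (mem_inter.1 hb).2⟩
      have hB1 : (s ∩ B).card ≤ 1 := card_le_one.2 fun a ha b hb => by
        by_contra hne
        have := h3.isClique (mem_inter.1 ha).1 (mem_inter.1 hb).1 hne
        exact this.2.2 ⟨(mem_inter.1 ha).2, (mem_inter.1 hb).2⟩
      have := card_union_le (s ∩ A) (s ∩ B)
      rw [← inter_union_distrib_left, inter_eq_left.2 hsAB, h3.card_eq] at this
      omega
    obtain ⟨s₀, hs₀⟩ := card_pos.1 (hU.symm ▸ t.succ_pos : 0 < U.card)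
    have : Nonempty (Fin n) := (hex s₀ hs₀).nonempty
    choose! f hfS hfs using hex
    have : U.card ≤ S.card := by
      refine card_le_card_of_injOn f hfS ?_
      intro s hs s' hs' he
      by_contra hne
      exact disjoint_left.1 (hdis hs hs' hne) (hfs s hs) (he ▸ hfs s' hs')
    omega
  have hle : G.edgeSet.ncard ≤ exTriangles n (t + 1) :=
    ncard_edgeSet_le_exTriangles hfree
  have h2 : adjCount G univ univ = 2 * G.edgeSet.ncard := adjCount_univ
  have hdeg : ∀ u : Fin n, n ≤ nbrCount G u univ +
      ((if u ∈ S then 1 else 0) + (if u ∈ A then α else 0) + (if u ∈ B then β else 0)) := by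
    intro u
    have hcov : (univ : Finset (Fin n)) ⊆ univ.filter (fun v => G.Adj u v) ∪
        ((if u ∈ S then {u} else ∅) ∪ (if u ∈ A then A else ∅) ∪ (if u ∈ B then B else ∅)) := by
      intro v _
      by_cases huS : u ∈ S
      · by_cases huv : u = v
        · simp [huS, huv.symm]
        · have : u ∉ A ∧ u ∉ B := by simpa [hSdef] using huS
          simp [G, huv, this]
      · have : u ∈ A ∨ u ∈ B := by
          by_contra! h'
          exact huS (by simpa [hSdef] using h')
        by_cases huv : u = v
        · subst huv
          rcases this with h' | h' <;> simp [h']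
        · by_cases h1 : u ∈ A ∧ v ∈ A
          · simp [h1]
          · by_cases h2 : u ∈ B ∧ v ∈ B
            · simp [h2]
            · refine mem_union_left _ (mem_filter.2 ⟨mem_univ _, huv, h1, h2⟩)
    have h1 := card_le_card hcov
    rw [card_univ, Fintype.card_fin] at h1
    refine h1.trans ((card_union_le _ _).trans ?_)
    unfold nbrCount
    refine Nat.add_le_add (le_of_eq (by congr)) ((card_union_le _ _).trans
      (Nat.add_le_add ((card_union_le _ _).trans (Nat.add_le_add ?_ ?_)) ?_))
    · split_ifs <;> simp
    · split_ifs <;> simp [hA]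
    · split_ifs <;> simp [hB]
  have hsum := sum_le_sum fun u (_ : u ∈ (univ : Finset (Fin n))) => hdeg u
  rw [sum_add_distrib, sum_add_distrib, sum_add_distrib] at hsum
  simp only [sum_const, card_univ, Fintype.card_fin, smul_eq_mul, sum_ite_mem, univ_inter,
    hS, hA, hB, mul_one] at hsum
  change n * n ≤ adjCount G univ univ + _ at hsum
  omega

theorem nbrCount_le_one_of_card_eq_two {n : ℕ} {H : SimpleGraph (Fin n)} {u : Fin n}
    {e : Finset (Fin n)} (he : e.card = 2) (h : ∃ v ∈ e, ¬ H.Adj u v) : nbrCount H u e ≤ 1 := by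
  obtain ⟨v, hv, hadj⟩ := h
  have := nbrCount_le_card_sub_one hv hadj
  omega

/-- A graph is bipartite on `W` if it has no triangle there, has almost `(|W| / 2) ^ 2` edges, and
the neighbourhoods of two adjacent vertices cover all but at most one vertex of `W`. -/
theorem colorable_two_of_triangle_free {n : ℕ} {H : SimpleGraph (Fin n)} {W : Finset (Fin n)}
    {a b : Fin n} {q : ℕ} (ha : a ∈ W) (hb : b ∈ W) (hab : H.Adj a b) (hW : W.card = 2 * q)
    (htri : ∀ f ⊆ W, ¬ H.IsNClique 3 f)
    (hdeg : 2 * q ≤ nbrCount H a W + nbrCount H b W + 1)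
    (hE : 2 * q * q + 4 ≤ adjCount H W W + 2 * q) :
    (H.induce (W : Set (Fin n))).Colorable 2 := by
  classical
  have htri' : ∀ x ∈ W, ∀ y ∈ W, ∀ z ∈ W, H.Adj x y → H.Adj x z → ¬ H.Adj y z := by
    intro x hx y hy z hz hxy hxz hyz
    refine htri {x, y, z} ?_ (SimpleGraph.is3Clique_triple_iff.2 ⟨hxy, hxz, hyz⟩)
    intro v hv
    simp only [mem_insert, mem_singleton] at hv
    rcases hv with rfl | rfl | rfl <;> assumption
  have hcol : ∀ X : Finset (Fin n),
      (∀ u ∈ W, ∀ v ∈ W, H.Adj u v → ¬ (u ∈ X ↔ v ∈ X)) →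
      (H.induce (W : Set (Fin n))).Colorable 2 := by
    intro X hX
    let C : (H.induce (W : Set (Fin n))).Coloring Bool :=
      SimpleGraph.Coloring.mk (fun v => decide (v.1 ∈ X)) fun {u v} huv he =>
        hX u.1 u.2 v.1 v.2 huv (decide_eq_decide.1 he)
    simpa using C.colorable
  set A := W.filter fun v => H.Adj a v with hAdef
  set B := W.filter fun v => H.Adj b v with hBdef
  have hAW : ∀ v ∈ A, v ∈ W := fun v hv => (mem_filter.1 hv).1
  have hBW : ∀ v ∈ B, v ∈ W := fun v hv => (mem_filter.1 hv).1
  have hAB : Disjoint A B := by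
    rw [disjoint_left]
    intro v hv hv'
    exact htri' a ha b hb v (hAW v hv) hab (mem_filter.1 hv).2 (mem_filter.1 hv').2
  have hAA : ∀ u ∈ A, ∀ v ∈ A, ¬ H.Adj u v := fun u hu v hv =>
    htri' a ha u (hAW u hu) v (hAW v hv) (mem_filter.1 hu).2 (mem_filter.1 hv).2
  have hBB : ∀ u ∈ B, ∀ v ∈ B, ¬ H.Adj u v := fun u hu v hv =>
    htri' b hb u (hBW u hu) v (hBW v hv) (mem_filter.1 hu).2 (mem_filter.1 hv).2
  have hABW : A ∪ B ⊆ W := union_subset (filter_subset _ _) (filter_subset _ _)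
  have hcA : nbrCount H a W = A.card := by unfold nbrCount; congr
  have hcB : nbrCount H b W = B.card := by unfold nbrCount; congr
  have hRcard : (W \ (A ∪ B)).card + (A.card + B.card) = 2 * q := by
    rw [← card_union_of_disjoint hAB, ← hW, card_sdiff_add_card_eq_card hABW]
  have hR1 : (W \ (A ∪ B)).card ≤ 1 := by omega
  have hout : ∀ u ∈ W, u ∉ A → u ∉ B → u ∈ W \ (A ∪ B) := fun u hu h1 h2 =>
    mem_sdiff.2 ⟨hu, fun h' => (mem_union.1 h').elim h1 h2⟩
  by_contra hnc
  have hexA : ∃ r ∈ W \ (A ∪ B), ∃ v ∈ A, H.Adj r v := by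
    by_contra! hcon
    refine hnc (hcol B fun u hu v hv huv hiff => ?_)
    by_cases huB : u ∈ B
    · exact hBB u huB v (hiff.1 huB) huv
    · have hvB : v ∉ B := fun h' => huB (hiff.2 h')
      by_cases huA : u ∈ A <;> by_cases hvA : v ∈ A
      · exact hAA u huA v hvA huv
      · exact hcon v (hout v hv hvA hvB) u huA huv.symm
      · exact hcon u (hout u hu huA huB) v hvA huv
      · exact huv.ne (card_le_one.1 hR1 u (hout u hu huA huB) v (hout v hv hvA hvB))
  have hexB : ∃ r ∈ W \ (A ∪ B), ∃ v ∈ B, H.Adj r v := by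
    by_contra! hcon
    refine hnc (hcol A fun u hu v hv huv hiff => ?_)
    by_cases huA : u ∈ A
    · exact hAA u huA v (hiff.1 huA) huv
    · have hvA : v ∉ A := fun h' => huA (hiff.2 h')
      by_cases huB : u ∈ B <;> by_cases hvB : v ∈ B
      · exact hBB u huB v hvB huv
      · exact hcon v (hout v hv hvA hvB) u huB huv.symm
      · exact hcon u (hout u hu huA huB) v hvB huv
      · exact huv.ne (card_le_one.1 hR1 u (hout u hu huA huB) v (hout v hv hvA hvB))
  obtain ⟨r, hr, p, hpA, hrp⟩ := hexA
  obtain ⟨r', hr', p', hpB, hrp'⟩ := hexB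
  obtain rfl := card_le_one.1 hR1 r hr r' hr'
  have hrW := (mem_sdiff.1 hr).1
  have hWeq : W = (A ∪ B) ∪ {r} := by
    have : W \ (A ∪ B) = {r} := by
      refine (eq_singleton_iff_unique_mem.2 ⟨hr, fun x hx => card_le_one.1 hR1 x hx r hr⟩)
    rw [← this, union_sdiff_of_subset hABW]
  have hdr : Disjoint (A ∪ B) {r} := disjoint_singleton_right.2 (mem_sdiff.1 hr).2
  have hWW : adjCount H W W = 2 * adjCount H A B + 2 * nbrCount H r A + 2 * nbrCount H r B := by
    have h0 : adjCount H {r} {r} = 0 := adjCount_self_eq_zero (by simp)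
    have h1 : ∀ Y, adjCount H {r} Y = nbrCount H r Y := fun Y => sum_singleton _ _
    rw [hWeq, adjCount_union_left hdr, adjCount_union_right hdr, adjCount_union_right hdr,
      adjCount_union_left hAB, adjCount_union_right hAB, adjCount_union_right hAB,
      adjCount_comm (A ∪ B) {r}, adjCount_union_right hAB, adjCount_self_eq_zero hAA,
      adjCount_self_eq_zero hBB, adjCount_comm B A, h0, h1, h1]
    ring
  have hsA : 0 < nbrCount H r A := card_pos.2 ⟨p, mem_filter.2 ⟨hpA, hrp⟩⟩
  have hsB : 0 < nbrCount H r B := card_pos.2 ⟨p', mem_filter.2 ⟨hpB, hrp'⟩⟩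
  have hcross : adjCount H A B + nbrCount H r A * nbrCount H r B ≤ A.card * B.card := by
    have hu : ∀ u ∈ A, nbrCount H u B + (if H.Adj r u then nbrCount H r B else 0) ≤ B.card := by
      intro u hu
      split_ifs with hru
      · unfold nbrCount
        rw [← card_union_of_disjoint]
        · exact card_le_card (union_subset (filter_subset _ _) (filter_subset _ _))
        · rw [disjoint_filter]
          intro v hv huv hrv
          exact htri' r hrW u (hAW u hu) v (hBW v hv) hru hrv huv
      · exact nbrCount_le_card u B
    have hs := sum_le_card_nsmul A _ _ hu
    rw [sum_add_distrib, ← sum_filter, sum_const, smul_eq_mul, smul_eq_mul] at hs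
    unfold adjCount
    have hAr : (A.filter fun v => H.Adj r v).card = nbrCount H r A := by unfold nbrCount; congr
    rwa [hAr] at hs
  have h1 : A.card + B.card + 1 = 2 * q := by
    have : 0 < (W \ (A ∪ B)).card := card_pos.2 ⟨r, hr⟩
    omega
  have h2 : A.card * B.card + q ≤ q * q := by
    zify at h1 ⊢
    have h3 : (q : ℤ) = A.card + 1 + (q - A.card - 1) := by ring
    generalize hd : (q : ℤ) - A.card - 1 = d at h3
    have hB' : (B.card : ℤ) = A.card + 1 + 2 * d := by linarith
    rw [hB', h3]
    have hdd : 0 ≤ d * (d + 1) := by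
      rcases le_or_gt 0 d with h | h
      · positivity
      · exact mul_nonneg_of_nonpos_of_nonpos h.le h
    linarith
  rw [hWW] at hE
  have hmul : nbrCount H r A + nbrCount H r B ≤ nbrCount H r A * nbrCount H r B + 1 := by
    obtain ⟨x, hx⟩ := Nat.exists_eq_add_of_lt hsA
    obtain ⟨y, hy⟩ := Nat.exists_eq_add_of_lt hsB
    rw [hx, hy]
    nlinarith [Nat.zero_le (x * y)]
  linarith

namespace IsCriticalTiling

variable {n : ℕ} {H : SimpleGraph (Fin n)} {T M : Finset (Finset (Fin n))} {I : Finset (Fin n)}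
  {T₁ : Finset (Finset (Fin n))} {c : Finset (Fin n) → Fin n}

theorem isNClique_insert_core (h : IsCriticalTiling H T M I T₁ c) {s : Finset (Fin n)}
    (hs : s ∈ T₁ ∪ M) {u : Fin n} (hu : ∀ v ∈ core T₁ c s, H.Adj u v) :
    H.IsNClique 3 (insert u (core T₁ c s)) :=
  (h.isNClique_core hs).insert hu

theorem nbrCount_core_le_one (h : IsCriticalTiling H T M I T₁ c) {s s' : Finset (Fin n)}
    (hs : s ∈ T₁ ∪ M) (hs' : s' ∈ T₁ ∪ M) {u : Fin n} (hu : u ∈ core T₁ c s ∪ I) :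
    nbrCount H u (core T₁ c s') ≤ 1 := by
  classical
  apply nbrCount_le_one_of_card_eq_two (h.isNClique_core hs').card_eq
  by_contra! hcon
  refine h.not_triangle_of_card_le_two (S := {s, s'}) ?_ card_le_two ?_
    (h.isNClique_insert_core hs' hcon)
  · intro x hx
    rcases mem_insert.1 hx with rfl | hx
    · exact hs
    · exact mem_singleton.1 hx ▸ hs'
  · simp only [biUnion_insert, singleton_biUnion]
    intro x hx
    simp only [mem_insert, mem_union] at hx hu ⊢
    rcases hx with rfl | hx <;> tauto

theorem disjoint_core (h : IsCriticalTiling H T M I T₁ c) {s s' : Finset (Fin n)}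
    (hs : s ∈ T₁ ∪ M) (hs' : s' ∈ T₁ ∪ M) (hne : s ≠ s') :
    Disjoint (core T₁ c s) (core T₁ c s') :=
  disjoint_left.2 fun _ hv hv' => hne (h.eq_of_mem_core hs hs' hv hv')

theorem nbrCount_coreVerts (h : IsCriticalTiling H T M I T₁ c) (u : Fin n) :
    nbrCount H u (coreVerts M T₁ c) = ∑ s ∈ T₁ ∪ M, nbrCount H u (core T₁ c s) :=
  nbrCount_biUnion (fun _ hs _ hs' hne => h.disjoint_core hs hs' hne) u

theorem card_coreVerts (h : IsCriticalTiling H T M I T₁ c) :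
    (coreVerts M T₁ c).card = 2 * (T₁ ∪ M).card := by
  unfold coreVerts
  rw [card_biUnion fun _ hs _ hs' hne => h.disjoint_core hs hs' hne,
    sum_congr rfl fun s hs => (h.isNClique_core hs).card_eq]
  simp [mul_comm]

theorem nbrCount_coreVerts_le (h : IsCriticalTiling H T M I T₁ c) {u : Fin n}
    (hu : u ∈ coreVerts M T₁ c ∪ I) :
    nbrCount H u (coreVerts M T₁ c) ≤ (T₁ ∪ M).card := by
  rw [h.nbrCount_coreVerts]
  have : ∀ s ∈ T₁ ∪ M, nbrCount H u (core T₁ c s) ≤ 1 := by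
    intro s' hs'
    rcases mem_union.1 hu with hu | hu
    · obtain ⟨s, hs, hus⟩ := mem_biUnion.1 hu
      exact h.nbrCount_core_le_one hs hs' (mem_union_left _ hus)
    · exact h.nbrCount_core_le_one hs' hs' (mem_union_right _ hu)
  simpa using sum_le_card_nsmul _ _ 1 this

theorem adjCount_coreVerts_self_le (h : IsCriticalTiling H T M I T₁ c) :
    adjCount H (coreVerts M T₁ c) (coreVerts M T₁ c) ≤ 2 * (T₁ ∪ M).card * (T₁ ∪ M).card := by
  rw [← h.card_coreVerts]
  exact adjCount_le_mul fun u hu => h.nbrCount_coreVerts_le (mem_union_left _ hu)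

/-- The cores both of whose vertices are adjacent to `u`. -/
noncomputable def seenCores (H : SimpleGraph (Fin n)) (M T₁ : Finset (Finset (Fin n)))
    (c : Finset (Fin n) → Fin n) (u : Fin n) : Finset (Finset (Fin n)) := by
  classical exact (T₁ ∪ M).filter fun s => ∀ v ∈ core T₁ c s, H.Adj u v

theorem mem_seenCores {u : Fin n} {s : Finset (Fin n)} :
    s ∈ seenCores H M T₁ c u ↔ s ∈ T₁ ∪ M ∧ ∀ v ∈ core T₁ c s, H.Adj u v := by
  classical
  unfold seenCores
  exact mem_filter

theorem nbrCount_coreVerts_le_add (h : IsCriticalTiling H T M I T₁ c) (u : Fin n) :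
    nbrCount H u (coreVerts M T₁ c) ≤ (T₁ ∪ M).card + (seenCores H M T₁ c u).card := by
  classical
  rw [h.nbrCount_coreVerts]
  have : ∀ s ∈ T₁ ∪ M, nbrCount H u (core T₁ c s) ≤
      1 + if s ∈ seenCores H M T₁ c u then 1 else 0 := by
    intro s hs
    split_ifs with hsee
    · exact (nbrCount_le_card _ _).trans (h.isNClique_core hs).card_eq.le
    · refine nbrCount_le_one_of_card_eq_two (h.isNClique_core hs).card_eq ?_
      by_contra! hcon
      exact hsee (mem_seenCores.2 ⟨hs, hcon⟩)
  refine (sum_le_sum this).trans ?_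
  rw [sum_add_distrib, ← sum_filter, sum_const, sum_const, smul_eq_mul, smul_eq_mul, mul_one,
    mul_one]
  exact Nat.add_le_add_left (card_le_card fun s hs => (mem_filter.1 hs).2) _

theorem eq_of_mem_seenCores (h : IsCriticalTiling H T M I T₁ c) {d : Finset (Fin n)}
    (hd : d ∈ T \ T₁) {u u' : Fin n} (hu : u ∈ d) (hu' : u' ∈ d) (hne : u ≠ u')
    {s s' : Finset (Fin n)} (hs : s ∈ T₁) (hs' : s' ∈ T₁) (hsu : s ∈ seenCores H M T₁ c u)
    (hsu' : s' ∈ seenCores H M T₁ c u') : s = s' := by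
  classical
  by_contra hss
  rw [mem_seenCores] at hsu hsu'
  have hnot : ∀ v ∈ d, ∀ r ∈ T₁, v ∉ core T₁ c r := by
    intro v hv r hr hvr
    have := h.eq_of_mem (mem_union_left _ (mem_sdiff.1 hd).1) (mem_union_left _ (h.sub hr)) hv
      (core_subset _ hvr)
    exact (mem_sdiff.1 hd).2 (this ▸ hr)
  have hdisj : Disjoint (insert u (core T₁ c s)) (insert u' (core T₁ c s')) := by
    rw [disjoint_insert_left, disjoint_insert_right, mem_insert, not_or]
    exact ⟨⟨hne, hnot u hu s' hs'⟩, hnot u' hu' s hs, h.disjoint_core hsu.1 hsu'.1 hss⟩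
  have hneq : insert u (core T₁ c s) ≠ insert u' (core T₁ c s') := by
    intro he
    rw [he, disjoint_self] at hdisj
    exact (insert_ne_empty _ _) hdisj
  have hS : ({s, s'} : Finset (Finset (Fin n))).card ≤ 2 := card_le_two
  have := h.augment (F := {insert u (core T₁ c s), insert u' (core T₁ c s')}) (S := {s, s'})
    (K := ∅) (D := {d}) ?_ ?_ ?_ (by simp) (by simpa using hd) ?_ ?_
  · rw [card_pair hneq] at this
    simp at this
  · intro f hf
    rcases mem_insert.1 hf with rfl | hf
    · exact h.isNClique_insert_core hsu.1 hsu.2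
    · rw [mem_singleton.1 hf]
      exact h.isNClique_insert_core hsu'.1 hsu'.2
  · intro f hf g hg hfg
    simp only [mem_insert, mem_singleton] at hf hg
    rcases hf with rfl | rfl <;> rcases hg with rfl | rfl
    · exact absurd rfl hfg
    · exact hdisj
    · exact hdisj.symm
    · exact absurd rfl hfg
  · intro x hx
    rcases mem_insert.1 hx with rfl | hx
    · exact hsu.1
    · exact mem_singleton.1 hx ▸ hsu'.1
  · intro f hf x hx
    simp only [mem_insert, mem_singleton] at hf
    simp only [biUnion_insert, singleton_biUnion, mem_union, id]
    rcases hf with rfl | rfl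
    · rcases mem_insert.1 hx with rfl | hx <;> tauto
    · rcases mem_insert.1 hx with rfl | hx <;> tauto
  · intro r _ hr _
    have := h.two_le r hr
    simp only [sdiff_empty]
    omega

theorem adjCount_triangle_coreVerts_le (h : IsCriticalTiling H T M I T₁ c)
    {d : Finset (Fin n)} (hd : d ∈ T \ T₁)
    (hsees : ∀ e ∈ M, ∀ e' ∈ M, sees H e d → sees H e' d → e = e') :
    adjCount H d (coreVerts M T₁ c) ≤ 3 * (T₁ ∪ M).card + T₁.card + 6 := by
  classical
  have hd3 : d.card = 3 := (h.tri d (mem_sdiff.1 hd).1).card_eq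
  have hM : ∀ u ∈ d, (seenCores H M T₁ c u ∩ M).card ≤ 1 := by
    intro u hu
    refine card_le_one.2 fun e he e' he' => ?_
    have hse : ∀ e ∈ seenCores H M T₁ c u ∩ M, sees H e d := by
      intro e he
      rw [mem_inter, mem_seenCores] at he
      rw [h.core_of_mem_M he.2] at he
      exact ⟨u, hu, fun v hv => (he.1.2 v hv).symm⟩
    exact hsees e (mem_inter.1 he).2 e' (mem_inter.1 he').2 (hse e he) (hse e' he')
  have hT : ∑ u ∈ d, (seenCores H M T₁ c u ∩ T₁).card ≤ T₁.card + 3 := by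
    by_cases hbig : ∃ u ∈ d, 1 < (seenCores H M T₁ c u ∩ T₁).card
    · obtain ⟨u, hu, hlt⟩ := hbig
      rw [← add_sum_erase _ _ hu, sum_eq_zero]
      · have : (seenCores H M T₁ c u ∩ T₁).card ≤ T₁.card := card_le_card inter_subset_right
        omega
      · intro u' hu'
        rw [card_eq_zero, eq_empty_iff_forall_notMem]
        intro s' hs'
        obtain ⟨s, hs, hne⟩ := exists_mem_ne hlt s'
        rw [mem_inter] at hs hs'
        exact hne (h.eq_of_mem_seenCores hd hu (mem_erase.1 hu').2 (mem_erase.1 hu').1.symm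
          hs.2 hs'.2 hs.1 hs'.1)
    · push Not at hbig
      have := sum_le_card_nsmul d _ 1 hbig
      simp only [hd3, smul_eq_mul, mul_one] at this
      omega
  have hu : ∀ u ∈ d, nbrCount H u (coreVerts M T₁ c) ≤
      ((T₁ ∪ M).card + 1) + (seenCores H M T₁ c u ∩ T₁).card := by
    intro u hu
    have h1 := h.nbrCount_coreVerts_le_add u
    have h2 : seenCores H M T₁ c u ⊆
        (seenCores H M T₁ c u ∩ T₁) ∪ (seenCores H M T₁ c u ∩ M) := by
      rw [← inter_union_distrib_left]
      exact fun s hs => mem_inter.2 ⟨hs, (mem_seenCores.1 hs).1⟩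
    have h3 := (card_le_card h2).trans (card_union_le _ _)
    have h4 := hM u hu
    omega
  have := sum_le_sum hu
  rw [sum_add_distrib, sum_const, hd3, smul_eq_mul] at this
  unfold adjCount
  omega

end IsCriticalTiling

namespace IsCriticalTiling

variable {n : ℕ} {H : SimpleGraph (Fin n)} {T M : Finset (Finset (Fin n))} {I : Finset (Fin n)}
  {T₁ : Finset (Finset (Fin n))} {c : Finset (Fin n) → Fin n}

theorem crit_injOn (h : IsCriticalTiling H T M I T₁ c) {s s' : Finset (Fin n)} (hs : s ∈ T₁)
    (hs' : s' ∈ T₁) (he : c s = c s') : s = s' :=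
  h.eq_of_mem (mem_union_left _ (h.sub hs)) (mem_union_left _ (h.sub hs')) (h.crit_mem s hs)
    (he ▸ h.crit_mem s' hs')

theorem card_image_crit (h : IsCriticalTiling H T M I T₁ c) : (T₁.image c).card = T₁.card :=
  card_image_of_injOn fun _ hs _ hs' he => h.crit_injOn hs hs' he

theorem adjCount_image_crit (h : IsCriticalTiling H T M I T₁ c) (Y : Finset (Fin n)) :
    adjCount H (T₁.image c) Y = ∑ s ∈ T₁, nbrCount H (c s) Y :=
  sum_image fun _ hs _ hs' he => h.crit_injOn hs hs' he

theorem pairwiseDisjoint_rest (h : IsCriticalTiling H T M I T₁ c) :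
    ((T \ T₁ : Finset (Finset (Fin n))) : Set (Finset (Fin n))).PairwiseDisjoint id :=
  fun _ hs _ hs' hne => h.disj (mem_union_left _ (mem_sdiff.1 hs).1)
    (mem_union_left _ (mem_sdiff.1 hs').1) hne

theorem card_biUnion_rest (h : IsCriticalTiling H T M I T₁ c) :
    ((T \ T₁).biUnion id).card = 3 * (T \ T₁).card := by
  rw [card_biUnion h.pairwiseDisjoint_rest]
  refine (sum_congr rfl fun s hs => (h.tri s (mem_sdiff.1 hs).1).card_eq).trans ?_
  simp [mul_comm]

theorem mem_coreVerts_or_crit (h : IsCriticalTiling H T M I T₁ c) {s : Finset (Fin n)}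
    (hs : s ∈ T₁ ∪ M) {v : Fin n} (hv : v ∈ s) :
    v ∈ T₁.image c ∨ v ∈ coreVerts M T₁ c := by
  by_cases hv' : v ∈ core T₁ c s
  · exact Or.inr (mem_biUnion.2 ⟨s, hs, hv'⟩)
  · rcases mem_union.1 hs with hs | hs
    · rw [core_of_mem hs, mem_erase, not_and] at hv'
      have : v = c s := by
        by_contra hne
        exact hv' hne hv
      exact Or.inl (mem_image.2 ⟨s, hs, this.symm⟩)
    · rw [h.core_of_mem_M hs] at hv'
      exact absurd hv hv'

theorem univ_eq (h : IsCriticalTiling H T M I T₁ c) :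
    (univ : Finset (Fin n)) =
      (T₁.image c ∪ coreVerts M T₁ c) ∪ ((T \ T₁).biUnion id ∪ I) := by
  classical
  refine (eq_univ_iff_forall.2 fun v => ?_).symm
  have hv := mem_univ v
  rw [← h.cover] at hv
  simp only [mem_union, mem_biUnion, id] at hv ⊢
  rcases hv with ⟨s, hs, hvs⟩ | hv
  · by_cases hsQ : s ∈ T₁ ∪ M
    · exact Or.inl (h.mem_coreVerts_or_crit hsQ hvs)
    · rw [mem_union, not_or] at hsQ
      exact Or.inr (Or.inl ⟨s, mem_sdiff.2 ⟨hs.resolve_right hsQ.2, hsQ.1⟩, hvs⟩)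
  · exact Or.inr (Or.inr hv)

theorem disjoint_crit_coreVerts (h : IsCriticalTiling H T M I T₁ c) :
    Disjoint (T₁.image c) (coreVerts M T₁ c) := by
  rw [disjoint_left]
  intro v hv hv'
  obtain ⟨s, hs, rfl⟩ := mem_image.1 hv
  obtain ⟨s', hs', hc⟩ := mem_biUnion.1 hv'
  exact h.crit_notMem_core hs hs' hc

theorem exists_mem_of_mem_crit_union (h : IsCriticalTiling H T M I T₁ c) {v : Fin n}
    (hv : v ∈ T₁.image c ∪ coreVerts M T₁ c) : ∃ s ∈ T₁ ∪ M, v ∈ s := by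
  rcases mem_union.1 hv with hv | hv
  · obtain ⟨s, hs, rfl⟩ := mem_image.1 hv
    exact ⟨s, mem_union_left _ hs, h.crit_mem s hs⟩
  · obtain ⟨s, hs, hc⟩ := mem_biUnion.1 hv
    exact ⟨s, hs, core_subset _ hc⟩

theorem disjoint_rest_I (h : IsCriticalTiling H T M I T₁ c) :
    Disjoint ((T \ T₁).biUnion id) I := by
  rw [disjoint_left]
  intro v hv
  obtain ⟨s, hs, hvs⟩ := mem_biUnion.1 hv
  exact h.notMem_I (mem_union_left _ (mem_sdiff.1 hs).1) hvs

theorem disjoint_crit_union_rest (h : IsCriticalTiling H T M I T₁ c) :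
    Disjoint (T₁.image c ∪ coreVerts M T₁ c) ((T \ T₁).biUnion id ∪ I) := by
  rw [disjoint_left]
  intro v hv hv'
  obtain ⟨s, hs, hvs⟩ := h.exists_mem_of_mem_crit_union hv
  rcases mem_union.1 hv' with hv' | hv'
  · obtain ⟨s', hs', hvs'⟩ := mem_biUnion.1 hv'
    have hsT := mem_sdiff.1 hs'
    have := h.eq_of_mem (h.mem_union_of_mem hs) (mem_union_left _ hsT.1) hvs hvs'
    subst this
    rcases mem_union.1 hs with hs | hs
    · exact hsT.2 hs
    · exact disjoint_left.1 h.disjoint_families hsT.1 hs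
  · exact h.notMem_I (h.mem_union_of_mem hs) hvs hv'

theorem card_eq (h : IsCriticalTiling H T M I T₁ c) :
    n = T₁.card + 2 * (T₁ ∪ M).card + 3 * (T \ T₁).card + I.card := by
  have := congrArg card h.univ_eq
  rw [card_univ, Fintype.card_fin, card_union_of_disjoint h.disjoint_crit_union_rest,
    card_union_of_disjoint h.disjoint_crit_coreVerts, card_union_of_disjoint h.disjoint_rest_I,
    h.card_image_crit, h.card_coreVerts, h.card_biUnion_rest] at this
  omega

theorem card_union_eq (h : IsCriticalTiling H T M I T₁ c) :
    (T₁ ∪ M).card = T₁.card + M.card :=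
  card_union_of_disjoint (disjoint_of_subset_left h.sub h.disjoint_families)

theorem adjCount_univ_le (h : IsCriticalTiling H T M I T₁ c)
    (hsees : ∀ d ∈ T \ T₁, ∀ e ∈ M, ∀ e' ∈ M, sees H e d → sees H e' d → e = e') :
    adjCount H univ univ + T₁.card ≤ T₁.card * T₁.card +
      2 * adjCount H (T₁.image c) (coreVerts M T₁ c) +
      adjCount H (coreVerts M T₁ c) (coreVerts M T₁ c) +
      2 * (T₁.card * (3 * (T \ T₁).card)) + 2 * (T₁.card * I.card) +
      2 * ((T \ T₁).card * (3 * (T₁ ∪ M).card + T₁.card + 6)) +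
      2 * (I.card * (T₁ ∪ M).card) +
      (3 * (T \ T₁).card) * (3 * (T \ T₁).card) + 2 * ((3 * (T \ T₁).card) * I.card) := by
  have hDW : adjCount H ((T \ T₁).biUnion id) (coreVerts M T₁ c) ≤
      (T \ T₁).card * (3 * (T₁ ∪ M).card + T₁.card + 6) := by
    unfold adjCount
    rw [sum_biUnion h.pairwiseDisjoint_rest]
    exact (sum_le_card_nsmul _ _ _ fun d hd =>
      h.adjCount_triangle_coreVerts_le hd (hsees d hd)).trans_eq (smul_eq_mul _ _)
  have hIW : adjCount H I (coreVerts M T₁ c) ≤ I.card * (T₁ ∪ M).card :=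
    adjCount_le_mul fun u hu => h.nbrCount_coreVerts_le (mem_union_right _ hu)
  have hII : adjCount H I I = 0 := adjCount_self_eq_zero h.indep
  have hCC := adjCount_self_add_card_le (H := H) (T₁.image c)
  have hCD := adjCount_le_card_mul_card (H := H) (T₁.image c) ((T \ T₁).biUnion id)
  have hCI := adjCount_le_card_mul_card (H := H) (T₁.image c) I
  have hDD := adjCount_le_card_mul_card (H := H) ((T \ T₁).biUnion id) ((T \ T₁).biUnion id)
  have hDI := adjCount_le_card_mul_card (H := H) ((T \ T₁).biUnion id) I
  rw [h.card_image_crit] at hCC hCD hCI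
  rw [h.card_biUnion_rest] at hCD hDD hDI
  have htotal : adjCount H univ univ = adjCount H (T₁.image c) (T₁.image c) +
      2 * adjCount H (T₁.image c) (coreVerts M T₁ c) +
      adjCount H (coreVerts M T₁ c) (coreVerts M T₁ c) +
      2 * adjCount H (T₁.image c) ((T \ T₁).biUnion id) + 2 * adjCount H (T₁.image c) I +
      2 * adjCount H ((T \ T₁).biUnion id) (coreVerts M T₁ c) +
      2 * adjCount H I (coreVerts M T₁ c) +
      adjCount H ((T \ T₁).biUnion id) ((T \ T₁).biUnion id) +
      2 * adjCount H ((T \ T₁).biUnion id) I + adjCount H I I := by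
    rw [h.univ_eq]
    simp only [adjCount_union_left h.disjoint_crit_union_rest,
      adjCount_union_right h.disjoint_crit_union_rest,
      adjCount_union_left h.disjoint_crit_coreVerts, adjCount_union_right h.disjoint_crit_coreVerts,
      adjCount_union_left h.disjoint_rest_I, adjCount_union_right h.disjoint_rest_I]
    rw [adjCount_comm (coreVerts M T₁ c) (T₁.image c),
      adjCount_comm ((T \ T₁).biUnion id) (T₁.image c), adjCount_comm I (T₁.image c),
      adjCount_comm (coreVerts M T₁ c) ((T \ T₁).biUnion id), adjCount_comm (coreVerts M T₁ c) I,
      adjCount_comm I ((T \ T₁).biUnion id)]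
    ring
  omega

/-- The number of edges of `H` forces the critical vertices and the cores to span almost as many
edges as possible. -/
theorem le_adjCount_coreVerts (h : IsCriticalTiling H T M I T₁ c)
    (hsees : ∀ d ∈ T \ T₁, ∀ e ∈ M, ∀ e' ∈ M, sees H e d → sees H e' d → e = e')
    {t : ℕ} (hT : T.card = t + 1) (hk : (T \ T₁).card ≤ 2)
    (hM : 2 * I.card + 50 ≤ M.card)
    (hedges : H.edgeSet.ncard = exTriangles n (t + 1) + 2) :
    2 * (T₁ ∪ M).card * (T₁ ∪ M).card + 4 * (T₁.card * (T₁ ∪ M).card) + 4 ≤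
      adjCount H (coreVerts M T₁ c) (coreVerts M T₁ c) +
      2 * adjCount H (T₁.image c) (coreVerts M T₁ c) + 2 * (T₁ ∪ M).card := by
  have h1 := h.adjCount_univ_le hsees
  have h2 := h.card_eq
  have h3 := h.card_union_eq
  have h4 : (T \ T₁).card + T₁.card = t + 1 := by rw [card_sdiff_add_card_eq_card h.sub, hT]
  rw [adjCount_univ, hedges] at h1
  generalize (T \ T₁).card = k at *
  generalize (T₁ ∪ M).card = q at *
  generalize adjCount H (coreVerts M T₁ c) (coreVerts M T₁ c) = w at *
  generalize adjCount H (T₁.image c) (coreVerts M T₁ c) = x at *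
  generalize T₁.card = p at *
  generalize I.card = r at *
  generalize M.card = m at *
  have h5 := sq_le_two_mul_exTriangles (n := n) (t := t) (α := q + 1) (β := q + 2 * k + r)
    (by omega)
  generalize exTriangles n (t + 1) = E at *
  subst h2
  interval_cases k
  · obtain rfl : p = t + 1 := by omega
    subst h3
    nlinarith
  · obtain rfl : p = t := by omega
    subst h3
    nlinarith
  · obtain rfl : t = p + 1 := by omega
    subst h3
    nlinarith

end IsCriticalTiling

namespace IsCriticalTiling

variable {n : ℕ} {H : SimpleGraph (Fin n)} {T M : Finset (Finset (Fin n))} {I : Finset (Fin n)}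
  {T₁ : Finset (Finset (Fin n))} {c : Finset (Fin n) → Fin n}

theorem disjoint_insert_core (h : IsCriticalTiling H T M I T₁ c) {S : Finset (Finset (Fin n))}
    (hS : S ⊆ T₁ ∪ M) {f a s : Finset (Fin n)} (hf : f ⊆ S.biUnion (core T₁ c)) (ha : a ∈ T₁)
    (hs : s ∈ T₁ ∪ M) (hsS : s ∉ S) : Disjoint f (insert (c a) (core T₁ c s)) := by
  rw [disjoint_left]
  intro v hv hv'
  obtain ⟨s', hs', hvs'⟩ := mem_biUnion.1 (hf hv)
  rcases mem_insert.1 hv' with rfl | hv'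
  · exact h.crit_notMem_core ha (hS hs') hvs'
  · exact hsS (h.eq_of_mem_core hs (hS hs') hv' hvs' ▸ hs')

theorem exists_card_seers_lt_of_seen (h : IsCriticalTiling H T M I T₁ c)
    {S : Finset (Finset (Fin n))} (hS : S ⊆ T₁ ∪ M) {f a s : Finset (Fin n)}
    (hf : H.IsNClique 3 f) (hfS : f ⊆ S.biUnion (core T₁ c)) (haS : a ∈ S) (ha : a ∈ T₁)
    (hs : s ∈ seenCores H M T₁ c (c a)) (hsS : s ∉ S) :
    ∃ s' ∈ insert s S, s' ∈ T₁ ∧ s' ≠ a ∧ (seers H M c s').card < S.card := by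
  classical
  rw [mem_seenCores] at hs
  have hd := h.disjoint_insert_core hS hfS ha hs.1 hsS
  have hne : f ≠ insert (c a) (core T₁ c s) := by
    rintro he
    rw [← he, disjoint_self] at hd
    have := hf.card_eq
    simp [hd] at this
  by_contra! hcon
  have := h.augment (F := {f, insert (c a) (core T₁ c s)}) (S := insert s S) (K := {a}) (D := ∅)
    ?_ ?_ (insert_subset hs.1 hS) (by simpa) (by simp) ?_ ?_
  · rw [card_pair hne] at this
    simp at this
  · intro g hg
    rcases mem_insert.1 hg with rfl | hg
    · exact hf
    · rw [mem_singleton.1 hg]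
      exact h.isNClique_insert_core hs.1 hs.2
  · intro g hg g' hg' hgg
    rw [mem_insert, mem_singleton] at hg hg'
    rcases hg with rfl | rfl <;> rcases hg' with rfl | rfl
    · exact absurd rfl hgg
    · exact hd
    · exact hd.symm
    · exact absurd rfl hgg
  · intro g hg
    rw [mem_insert, mem_singleton] at hg
    rcases hg with rfl | rfl
    · intro v hv
      have := hfS hv
      simp only [biUnion_insert, mem_union]
      tauto
    · intro v hv
      rw [mem_insert] at hv
      simp only [biUnion_insert, mem_union, image_singleton, mem_singleton]
      tauto
  · intro s' hs' hs'T hs'a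
    refine le_trans ?_ (hcon s' hs' hs'T (by simpa using hs'a))
    have h1 : (insert s S \ {a}).card + 1 = (insert s S).card := by
      rw [sdiff_singleton_eq_erase, card_erase_add_one (mem_insert_of_mem haS)]
    have h2 := card_insert_le s S
    omega

theorem exists_card_seers_lt_of_seen_of_seen (h : IsCriticalTiling H T M I T₁ c)
    {S : Finset (Finset (Fin n))} (hS : S ⊆ T₁ ∪ M) {f a b s e : Finset (Fin n)}
    (hf : H.IsNClique 3 f) (hfS : f ⊆ S.biUnion (core T₁ c)) (haS : a ∈ S) (ha : a ∈ T₁)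
    (hbS : b ∈ S) (hb : b ∈ T₁) (hab : a ≠ b)
    (hs : s ∈ seenCores H M T₁ c (c a)) (hsS : s ∉ S)
    (he : e ∈ seenCores H M T₁ c (c b)) (heS : e ∉ S) (hse : s ≠ e) :
    ∃ s' ∈ insert e (insert s S), s' ∈ T₁ ∧ s' ≠ a ∧ s' ≠ b ∧
      (seers H M c s').card < S.card := by
  classical
  rw [mem_seenCores] at hs he
  have hd := h.disjoint_insert_core hS hfS ha hs.1 hsS
  have hd' := h.disjoint_insert_core hS hfS hb he.1 heS
  have hd'' : Disjoint (insert (c a) (core T₁ c s)) (insert (c b) (core T₁ c e)) := by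
    rw [disjoint_insert_left]
    refine ⟨fun hc => ?_, ?_⟩
    · rcases mem_insert.1 hc with hc | hc
      · exact hab (h.crit_injOn ha hb hc)
      · exact h.crit_notMem_core ha he.1 hc
    · exact h.disjoint_insert_core (S := {s}) (by simpa using hs.1) (by simp) hb he.1
        (by simpa using hse.symm)
  have hne : ∀ {g g' : Finset (Fin n)}, H.IsNClique 3 g → Disjoint g g' → g ≠ g' := by
    rintro g g' hg hgg rfl
    rw [disjoint_self] at hgg
    have := hg.card_eq
    simp [hgg] at this
  have hF1 := h.isNClique_insert_core hs.1 hs.2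
  have hF2 := h.isNClique_insert_core he.1 he.2
  by_contra! hcon
  have := h.augment (F := {f, insert (c a) (core T₁ c s), insert (c b) (core T₁ c e)})
    (S := insert e (insert s S)) (K := {a, b}) (D := ∅)
    ?_ ?_ (insert_subset he.1 (insert_subset hs.1 hS)) ?_ (by simp) ?_ ?_
  · rw [card_pair hab, card_insert_of_notMem, card_pair (hne hF1 hd'')] at this
    · simp at this
    · rw [mem_insert, mem_singleton, not_or]
      exact ⟨hne hf hd, hne hf hd'⟩
  · intro g hg
    simp only [mem_insert, mem_singleton] at hg
    rcases hg with rfl | rfl | rfl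
    · exact hf
    · exact hF1
    · exact hF2
  · intro g hg g' hg' hgg
    simp only [mem_insert, mem_singleton] at hg hg'
    rcases hg with rfl | rfl | rfl <;> rcases hg' with rfl | rfl | rfl
    · exact absurd rfl hgg
    · exact hd
    · exact hd'
    · exact hd.symm
    · exact absurd rfl hgg
    · exact hd''
    · exact hd'.symm
    · exact hd''.symm
    · exact absurd rfl hgg
  · intro k hk
    rw [mem_insert, mem_singleton] at hk
    rcases hk with rfl | rfl <;> assumption
  · intro g hg
    simp only [mem_insert, mem_singleton] at hg
    rcases hg with rfl | rfl | rfl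
    · intro v hv
      have := hfS hv
      simp only [biUnion_insert, mem_union]
      tauto
    · intro v hv
      rw [mem_insert] at hv
      simp only [biUnion_insert, mem_union, image_insert, image_singleton, mem_singleton,
        mem_insert]
      tauto
    · intro v hv
      rw [mem_insert] at hv
      simp only [biUnion_insert, mem_union, image_insert, image_singleton, mem_singleton,
        mem_insert]
      tauto
  · intro s' hs' hs'T hs'K
    rw [mem_insert, mem_singleton, not_or] at hs'K
    refine le_trans ?_ (hcon s' hs' hs'T hs'K.1 hs'K.2)
    have h1 : (insert e (insert s S) \ {a, b}).card + 2 = (insert e (insert s S)).card := by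
      rw [← card_pair hab]
      refine card_sdiff_add_card_eq_card fun k hk => ?_
      rw [mem_insert, mem_singleton] at hk
      rcases hk with rfl | rfl <;> simp [*]
    have h2 := card_insert_le s S
    have h3 := card_insert_le e (insert s S)
    omega

theorem seers_subset_seenCores (h : IsCriticalTiling H T M I T₁ c) {s : Finset (Fin n)} :
    seers H M c s ⊆ seenCores H M T₁ c (c s) := by
  intro e he
  rw [mem_seers] at he
  rw [mem_seenCores, h.core_of_mem_M he.1]
  exact ⟨mem_union_right _ he.1, fun v hv => (he.2.2 v hv).symm⟩

theorem seenCores_subset (h : IsCriticalTiling H T M I T₁ c) {s : Finset (Fin n)} (hs : s ∈ T₁) :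
    seenCores H M T₁ c (c s) ⊆ T₁ ∪ seers H M c s := by
  intro e he
  rw [mem_seenCores, mem_union] at he
  rcases he with ⟨he | he, hadj⟩
  · exact mem_union_left _ he
  · rw [h.core_of_mem_M he] at hadj
    exact mem_union_right _ (mem_seers.2 ⟨he, h.crit_mem s hs, fun v hv => (hadj v hv).symm⟩)

theorem nbrCount_crit_le (h : IsCriticalTiling H T M I T₁ c) {s : Finset (Fin n)} (hs : s ∈ T₁) :
    nbrCount H (c s) (coreVerts M T₁ c) ≤
      (T₁ ∪ M).card + T₁.card + (seers H M c s).card := by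
  have h1 := h.nbrCount_coreVerts_le_add (c s)
  have h2 := card_le_card (h.seenCores_subset hs)
  have h3 := card_union_le T₁ (seers H M c s)
  omega

theorem le_sum_nbrCount_crit (h : IsCriticalTiling H T M I T₁ c)
    (hE : 2 * (T₁ ∪ M).card * (T₁ ∪ M).card + 4 * (T₁.card * (T₁ ∪ M).card) + 4 ≤
      adjCount H (coreVerts M T₁ c) (coreVerts M T₁ c) +
      2 * adjCount H (T₁.image c) (coreVerts M T₁ c) + 2 * (T₁ ∪ M).card)
    {B : Finset (Finset (Fin n))} (hB : B ⊆ T₁) :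
    2 * (T₁ ∪ M).card * (T₁ ∪ M).card + 4 * (B.card * (T₁ ∪ M).card) + 4 ≤
      adjCount H (coreVerts M T₁ c) (coreVerts M T₁ c) +
      2 * (∑ s ∈ B, nbrCount H (c s) (coreVerts M T₁ c)) + 2 * (T₁ ∪ M).card := by
  rw [h.adjCount_image_crit, ← sum_sdiff hB] at hE
  have h1 : ∑ s ∈ T₁ \ B, nbrCount H (c s) (coreVerts M T₁ c) ≤
      (T₁ \ B).card * (2 * (T₁ ∪ M).card) := by
    rw [← h.card_coreVerts, ← smul_eq_mul]
    exact sum_le_card_nsmul _ _ _ fun s _ => nbrCount_le_card _ _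
  have h2 := card_sdiff_add_card_eq_card hB
  rw [← h2] at hE
  nlinarith

/-- At most two triangles of `T₁` are seen by fewer than three edges of `M`. -/
theorem card_filter_seers_le_two (h : IsCriticalTiling H T M I T₁ c)
    (hE : 2 * (T₁ ∪ M).card * (T₁ ∪ M).card + 4 * (T₁.card * (T₁ ∪ M).card) + 4 ≤
      adjCount H (coreVerts M T₁ c) (coreVerts M T₁ c) +
      2 * adjCount H (T₁.image c) (coreVerts M T₁ c) + 2 * (T₁ ∪ M).card)
    (hpM : T₁.card + 4 < 2 * M.card) :
    (T₁.filter fun s => (seers H M c s).card < 3).card ≤ 2 := by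
  by_contra! hlt
  obtain ⟨B, hB, hB3⟩ := exists_subset_card_eq (Nat.succ_le_of_lt hlt)
  have h1 := h.le_sum_nbrCount_crit hE (hB.trans (filter_subset _ _))
  have h2 : ∑ s ∈ B, nbrCount H (c s) (coreVerts M T₁ c) ≤
      B.card * ((T₁ ∪ M).card + T₁.card + 2) := by
    rw [← smul_eq_mul]
    refine sum_le_card_nsmul _ _ _ fun s hs => ?_
    obtain ⟨hs, hs2⟩ := mem_filter.1 (hB hs)
    have := h.nbrCount_crit_le hs
    omega
  have h3 := h.adjCount_coreVerts_self_le
  have h4 := h.card_union_eq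
  rw [hB3] at h1 h2
  omega

theorem card_filter_nbrCount_eq_zero_add_le (h : IsCriticalTiling H T M I T₁ c) {u : Fin n}
    (hu : u ∈ coreVerts M T₁ c) :
    ((T₁ ∪ M).filter fun s => nbrCount H u (core T₁ c s) = 0).card +
      nbrCount H u (coreVerts M T₁ c) ≤ (T₁ ∪ M).card := by
  obtain ⟨s', hs', hu'⟩ := mem_biUnion.1 hu
  rw [h.nbrCount_coreVerts, card_filter, ← sum_add_distrib, card_eq_sum_ones]
  refine sum_le_sum fun s hs => ?_
  have := h.nbrCount_core_le_one hs' hs (mem_union_left _ hu')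
  split_ifs <;> omega

theorem adjCount_coreVerts_le_of_mem (h : IsCriticalTiling H T M I T₁ c) {u : Fin n}
    (hu : u ∈ coreVerts M T₁ c) :
    adjCount H (coreVerts M T₁ c) (coreVerts M T₁ c) + (T₁ ∪ M).card ≤
      nbrCount H u (coreVerts M T₁ c) + 2 * (T₁ ∪ M).card * (T₁ ∪ M).card := by
  have h1 : adjCount H (coreVerts M T₁ c) (coreVerts M T₁ c) =
      nbrCount H u (coreVerts M T₁ c) +
        adjCount H ((coreVerts M T₁ c).erase u) (coreVerts M T₁ c) :=
    (add_sum_erase _ _ hu).symm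
  have h2 : adjCount H ((coreVerts M T₁ c).erase u) (coreVerts M T₁ c) ≤
      ((coreVerts M T₁ c).erase u).card * (T₁ ∪ M).card :=
    adjCount_le_mul fun v hv => h.nbrCount_coreVerts_le (mem_union_left _ (mem_of_mem_erase hv))
  have h3 := card_erase_add_one hu
  rw [h.card_coreVerts] at h3
  rw [← h3]
  nlinarith

end IsCriticalTiling

namespace IsCriticalTiling

variable {n : ℕ} {H : SimpleGraph (Fin n)} {T M : Finset (Finset (Fin n))} {I : Finset (Fin n)}
  {T₁ : Finset (Finset (Fin n))} {c : Finset (Fin n) → Fin n}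

/-- A triangle in the cores meets three distinct cores, one of which belongs to a triangle of `T₁`
seen by fewer than three edges of `M`. -/
theorem exists_of_triangle (h : IsCriticalTiling H T M I T₁ c) {f : Finset (Fin n)}
    (hf : H.IsNClique 3 f) (hfW : f ⊆ coreVerts M T₁ c) :
    ∃ a ∈ T₁, ∃ b ∈ T₁ ∪ M, ∃ d ∈ T₁ ∪ M, a ≠ b ∧ a ≠ d ∧ b ≠ d ∧
      (seers H M c a).card < 3 ∧
      ∃ x ∈ core T₁ c a, ∃ y ∈ core T₁ c b, ∃ z ∈ core T₁ c d,
        H.Adj x y ∧ H.Adj x z ∧ H.Adj y z := by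
  classical
  obtain ⟨x, y, z, hxy, hxz, hyz, rfl⟩ := SimpleGraph.is3Clique_iff.1 hf
  obtain ⟨a, ha, hxa⟩ := mem_biUnion.1 (hfW (by simp : x ∈ ({x, y, z} : Finset (Fin n))))
  obtain ⟨b, hb, hyb⟩ := mem_biUnion.1 (hfW (by simp : y ∈ ({x, y, z} : Finset (Fin n))))
  obtain ⟨d, hd, hzd⟩ := mem_biUnion.1 (hfW (by simp : z ∈ ({x, y, z} : Finset (Fin n))))
  have hsub : ({x, y, z} : Finset (Fin n)) ⊆
      ({a, b, d} : Finset (Finset (Fin n))).biUnion (core T₁ c) ∪ I := by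
    intro v hv
    simp only [mem_insert, mem_singleton, mem_union, mem_biUnion] at hv ⊢
    rcases hv with rfl | rfl | rfl
    · exact Or.inl ⟨a, by simp, hxa⟩
    · exact Or.inl ⟨b, by simp, hyb⟩
    · exact Or.inl ⟨d, by simp, hzd⟩
  have hS : ({a, b, d} : Finset (Finset (Fin n))) ⊆ T₁ ∪ M := by
    intro s hs
    simp only [mem_insert, mem_singleton] at hs
    rcases hs with rfl | rfl | rfl <;> assumption
  have hab : a ≠ b := by
    rintro rfl
    refine h.not_triangle_of_card_le_two hS ?_ hsub hf
    rw [insert_idem]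
    exact card_le_two
  have had : a ≠ d := by
    rintro rfl
    refine h.not_triangle_of_card_le_two hS ?_ hsub hf
    rw [insert_comm, pair_eq_singleton]
    exact card_le_two
  have hbd : b ≠ d := by
    rintro rfl
    refine h.not_triangle_of_card_le_two hS ?_ hsub hf
    rw [pair_eq_singleton]
    exact card_le_two
  obtain ⟨s, hs, hsT, hlt⟩ := h.exists_card_seers_lt hS hf hsub
  replace hlt := hlt.trans_le card_le_three
  simp only [mem_insert, mem_singleton] at hs
  rcases hs with rfl | rfl | rfl
  · exact ⟨s, hsT, b, hb, d, hd, hab, had, hbd, hlt, x, hxa, y, hyb, z, hzd, hxy, hxz, hyz⟩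
  · exact ⟨s, hsT, a, ha, d, hd, hab.symm, hbd, had, hlt, y, hyb, x, hxa, z, hzd, hxy.symm, hyz,
      hxz⟩
  · exact ⟨s, hsT, a, ha, b, hb, had.symm, hbd.symm, hab, hlt, z, hzd, x, hxa, y, hyb, hxz.symm,
      hyz.symm, hxy⟩

/-- The edge count leaves no room for two triangles of `T₁` seen by fewer than three edges of `M`
if the critical vertex of one of them sees few cores. -/
theorem not_card_seenCores_le_four (h : IsCriticalTiling H T M I T₁ c)
    (hE : 2 * (T₁ ∪ M).card * (T₁ ∪ M).card + 4 * (T₁.card * (T₁ ∪ M).card) + 4 ≤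
      adjCount H (coreVerts M T₁ c) (coreVerts M T₁ c) +
      2 * adjCount H (T₁.image c) (coreVerts M T₁ c) + 2 * (T₁ ∪ M).card)
    (hM : 50 ≤ M.card) {a b : Finset (Fin n)} (ha : a ∈ T₁) (hb : b ∈ T₁) (hab : a ≠ b)
    (hb3 : (seers H M c b).card < 3) : ¬ (seenCores H M T₁ c (c a)).card ≤ 4 := by
  classical
  intro h4
  have h1 := h.le_sum_nbrCount_crit hE (B := {a, b}) (by
    intro k hk
    rw [mem_insert, mem_singleton] at hk
    rcases hk with rfl | rfl <;> assumption)
  rw [card_pair hab, sum_pair hab] at h1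
  have h2 := h.nbrCount_coreVerts_le_add (c a)
  have h3 := h.nbrCount_crit_le hb
  have h5 := h.adjCount_coreVerts_self_le
  have h6 := h.card_union_eq
  omega

theorem not_triangle (h : IsCriticalTiling H T M I T₁ c)
    (hE : 2 * (T₁ ∪ M).card * (T₁ ∪ M).card + 4 * (T₁.card * (T₁ ∪ M).card) + 4 ≤
      adjCount H (coreVerts M T₁ c) (coreVerts M T₁ c) +
      2 * adjCount H (T₁.image c) (coreVerts M T₁ c) + 2 * (T₁ ∪ M).card)
    (hM : 50 ≤ M.card) (hpM : T₁.card + 4 < 2 * M.card)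
    {f : Finset (Fin n)} (hfW : f ⊆ coreVerts M T₁ c) : ¬ H.IsNClique 3 f := by
  classical
  intro hf
  obtain ⟨a, ha, b, hb, d, hd, hab, had, hbd, ha3, x, hx, y, hy, z, hz, hxy, hxz, hyz⟩ :=
    h.exists_of_triangle hf hfW
  have hS : ({a, b, d} : Finset (Finset (Fin n))) ⊆ T₁ ∪ M := by
    intro s hs
    simp only [mem_insert, mem_singleton] at hs
    rcases hs with rfl | rfl | rfl
    exacts [mem_union_left _ ha, hb, hd]
  have hS3 : ({a, b, d} : Finset (Finset (Fin n))).card = 3 := card_eq_three.2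
    ⟨a, b, d, hab, had, hbd, rfl⟩
  have htri := SimpleGraph.is3Clique_triple_iff.2 ⟨hxy, hxz, hyz⟩
  have hsub : ({x, y, z} : Finset (Fin n)) ⊆
      ({a, b, d} : Finset (Finset (Fin n))).biUnion (core T₁ c) := by
    intro v hv
    simp only [mem_insert, mem_singleton, mem_biUnion] at hv ⊢
    rcases hv with rfl | rfl | rfl
    · exact ⟨a, by simp, hx⟩
    · exact ⟨b, by simp, hy⟩
    · exact ⟨d, by simp, hz⟩
  have hB := h.card_filter_seers_le_two hE hpM
  -- every other triangle of `T₁` is seen by three edges of `M`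
  have honly : ∀ b' ∈ T₁, b' ≠ a → ¬ (seers H M c b').card < 3 := by
    intro b' hb' hba hb3
    have hB2 : ∀ s ∈ T₁, (seers H M c s).card < 3 → s = a ∨ s = b' := by
      intro s hs hs3
      by_contra! hcon
      have : ({a, b', s} : Finset (Finset (Fin n))) ⊆
          T₁.filter fun s => (seers H M c s).card < 3 := by
        intro k hk
        simp only [mem_insert, mem_singleton] at hk
        rcases hk with rfl | rfl | rfl <;> simp [*]
      have h3 := card_le_card this
      rw [card_eq_three.2 ⟨a, b', s, hba.symm, hcon.1.symm, hcon.2.symm, rfl⟩] at h3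
      omega
    refine h.not_card_seenCores_le_four hE hM ha hb' hba.symm hb3 ?_
    by_cases hbS : b' ∈ ({a, b, d} : Finset (Finset (Fin n)))
    · have hlt : 0 < (seers H M c b' \ {a, b, d}).card := by
        have h1 : seers H M c b' \ {a, b, d} = seers H M c b' \ ({b, d} : Finset _).erase b' := by
          ext e
          simp only [mem_sdiff, mem_insert, mem_singleton, mem_erase]
          refine and_congr_right fun he => not_congr ⟨?_, ?_⟩
          · rintro (rfl | he')
            · exact absurd ha (h.notMem_T₁ (mem_seers.1 he).1)
            · exact ⟨fun h' => h.notMem_T₁ (mem_seers.1 he).1 (h' ▸ hb'), he'⟩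
          · tauto
        have h2 := h.two_le b' hb'
        have h3 : b' ∈ ({b, d} : Finset (Finset (Fin n))) := by
          rw [mem_insert] at hbS
          exact hbS.resolve_left hba
        have h4 := card_erase_add_one h3
        rw [card_pair hbd] at h4
        have h5 := le_card_sdiff (({b, d} : Finset _).erase b') (seers H M c b')
        rw [h1]
        omega
      obtain ⟨e, he⟩ := card_pos.1 hlt
      rw [mem_sdiff] at he
      refine (card_le_card (t := insert e {a, b, d}) fun s hs => ?_).trans
        ((card_insert_le _ _).trans (by omega))
      by_contra hcon
      rw [mem_insert, not_or] at hcon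
      obtain ⟨s', hs', hs'T, hs'a, hs'b, hlt⟩ := h.exists_card_seers_lt_of_seen_of_seen hS htri
        hsub (by simp) ha hbS hb' hba.symm hs hcon.2 (h.seers_subset_seenCores he.1) he.2 hcon.1
      rw [hS3] at hlt
      rcases hB2 s' hs'T hlt with rfl | rfl <;> contradiction
    · refine (card_le_card (t := insert b' {a, b, d}) fun s hs => ?_).trans
        ((card_insert_le _ _).trans (by omega))
      by_contra hcon
      rw [mem_insert, not_or] at hcon
      obtain ⟨s', hs', hs'T, hs'a, hlt⟩ := h.exists_card_seers_lt_of_seen hS htri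
        hsub (by simp) ha hs hcon.2
      rw [hS3] at hlt
      rcases hB2 s' hs'T hlt with rfl | rfl
      · contradiction
      · rw [mem_insert] at hs'
        rcases hs' with rfl | hs'
        · exact hcon.1 rfl
        · contradiction
  have hseen : seenCores H M T₁ c (c a) ⊆ {a, b, d} := by
    intro s hs
    by_contra hcon
    obtain ⟨s', -, hs'T, hs'a, hlt⟩ := h.exists_card_seers_lt_of_seen hS htri
      hsub (by simp) ha hs hcon
    exact honly s' hs'T hs'a (hlt.trans_eq hS3)
  have hseers : seers H M c a = {b, d} := by
    refine eq_of_subset_of_card_le (fun e he => ?_) ?_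
    · have := hseen (h.seers_subset_seenCores he)
      rw [mem_insert] at this
      exact this.resolve_left fun h' => h.notMem_T₁ (mem_seers.1 he).1 (h' ▸ ha)
    · rw [card_pair hbd]
      exact h.two_le a ha
  have hbs : b ∈ seers H M c a := by simp [hseers]
  have hds : d ∈ seers H M c a := by simp [hseers]
  have hbM := (mem_seers.1 hbs).1
  have hdM := (mem_seers.1 hds).1
  have hA : 2 * (T₁ ∪ M).card * (T₁ ∪ M).card ≤
      adjCount H (coreVerts M T₁ c) (coreVerts M T₁ c) + 2 := by
    have h1 := h.le_sum_nbrCount_crit hE (B := {a}) (by simpa)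
    have h2 := h.nbrCount_coreVerts_le_add (c a)
    have h3 := card_le_card hseen
    rw [sum_singleton, card_singleton] at h1
    omega
  have hfew : ∀ u ∈ coreVerts M T₁ c,
      ((T₁ ∪ M).filter fun s => nbrCount H u (core T₁ c s) = 0).card ≤ 2 := by
    intro u hu
    have h1 := h.card_filter_nbrCount_eq_zero_add_le hu
    have h2 := h.adjCount_coreVerts_le_of_mem hu
    omega
  have hxW : x ∈ coreVerts M T₁ c := mem_biUnion.2 ⟨a, mem_union_left _ ha, hx⟩
  have hyW : y ∈ coreVerts M T₁ c := mem_biUnion.2 ⟨b, hb, hy⟩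
  have hzW : z ∈ coreVerts M T₁ c := mem_biUnion.2 ⟨d, hd, hz⟩
  obtain ⟨g, hgM, hg⟩ : ∃ g ∈ M, g ∉ ((T₁ ∪ M).filter fun s => nbrCount H x (core T₁ c s) = 0) ∪
      ((T₁ ∪ M).filter fun s => nbrCount H y (core T₁ c s) = 0) ∪
      ((T₁ ∪ M).filter fun s => nbrCount H z (core T₁ c s) = 0) ∪ {b, d} := by
    apply exists_mem_notMem_of_card_lt_card
    have h1 := hfew x hxW
    have h2 := hfew y hyW
    have h3 := hfew z hzW
    refine (card_union_le _ _).trans_lt ?_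
    have h4 := card_union_le (((T₁ ∪ M).filter fun s => nbrCount H x (core T₁ c s) = 0) ∪
      ((T₁ ∪ M).filter fun s => nbrCount H y (core T₁ c s) = 0))
      ((T₁ ∪ M).filter fun s => nbrCount H z (core T₁ c s) = 0)
    have h5 := card_union_le ((T₁ ∪ M).filter fun s => nbrCount H x (core T₁ c s) = 0)
      ((T₁ ∪ M).filter fun s => nbrCount H y (core T₁ c s) = 0)
    have h6 := card_pair hbd
    omega
  have hgQ : g ∈ T₁ ∪ M := mem_union_right _ hgM
  simp only [mem_union, mem_filter, mem_insert, mem_singleton, not_or, not_and] at hg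
  obtain ⟨⟨⟨hgx, hgy⟩, hgz⟩, hgb, hgd⟩ := hg
  obtain ⟨u, hu, hxu⟩ := exists_adj_of_nbrCount_pos
    (Nat.pos_of_ne_zero (hgx (Or.inr hgM)))
  obtain ⟨v, hv, hyv⟩ := exists_adj_of_nbrCount_pos
    (Nat.pos_of_ne_zero (hgy (Or.inr hgM)))
  obtain ⟨w, hw, hzw⟩ := exists_adj_of_nbrCount_pos
    (Nat.pos_of_ne_zero (hgz (Or.inr hgM)))
  -- a common neighbour of `x` and a vertex of one seeing edge frees the other one
  have hswap : ∀ b' d', b' ∈ M → d' ∈ M → d' ∈ seers H M c a → g ≠ d' → b' ≠ d' →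
      ∀ y' ∈ core T₁ c b', H.Adj x y' → ∀ u ∈ core T₁ c g, H.Adj x u → ¬ H.Adj y' u := by
    intro b' d' hb' hd' hds' hgd' hbd' y' hy' hxy' u hu hxu hyu
    have htri' := SimpleGraph.is3Clique_triple_iff.2 ⟨hxy', hxu, hyu⟩
    have hnot : ∀ s ∈ ({a, b', g} : Finset (Finset (Fin n))), s ∈ T₁ → s = a := by
      intro s hs hsT
      simp only [mem_insert, mem_singleton] at hs
      rcases hs with rfl | rfl | rfl
      · rfl
      · exact absurd hsT (h.notMem_T₁ hb')
      · exact absurd hsT (h.notMem_T₁ hgM)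
    have hS' : ({a, b', g} : Finset (Finset (Fin n))) ⊆ T₁ ∪ M := by
      intro s hs
      simp only [mem_insert, mem_singleton] at hs
      rcases hs with rfl | rfl | rfl
      exacts [mem_union_left _ ha, mem_union_right _ hb', hgQ]
    have hsub' : ({x, y', u} : Finset (Fin n)) ⊆
        ({a, b', g} : Finset (Finset (Fin n))).biUnion (core T₁ c) := by
      intro v hv
      simp only [mem_insert, mem_singleton, mem_biUnion] at hv ⊢
      rcases hv with rfl | rfl | rfl
      · exact ⟨a, by simp, hx⟩
      · exact ⟨b', by simp, hy'⟩
      · exact ⟨g, by simp, hu⟩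
    have hdS : d' ∉ ({a, b', g} : Finset (Finset (Fin n))) := by
      simp only [mem_insert, mem_singleton, not_or]
      exact ⟨fun h' => h.notMem_T₁ hd' (h' ▸ ha), hbd'.symm, hgd'.symm⟩
    obtain ⟨s', hs', hs'T, hs'a, -⟩ := h.exists_card_seers_lt_of_seen hS' htri' hsub' (by simp)
      ha (h.seers_subset_seenCores hds') hdS
    rcases mem_insert.1 hs' with rfl | hs'
    · exact h.notMem_T₁ hd' hs'T
    · exact hs'a (hnot s' hs' hs'T)
  obtain ⟨g₁, g₂, -, hg₁₂⟩ := card_eq_two.1 (h.isNClique_core hgQ).card_eq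
  have hcase : u = v ∨ u = w ∨ v = w := by
    rw [hg₁₂, mem_insert, mem_singleton] at hu hv hw
    rcases hu with rfl | rfl <;> rcases hv with rfl | rfl <;> rcases hw with rfl | rfl <;> simp
  rcases hcase with rfl | rfl | rfl
  · exact hswap b d hbM hdM hds hgd hbd y hy hxy u hu hxu hyv
  · exact hswap d b hdM hbM hbs hgb hbd.symm z hz hxz u hu hxu hzw
  · rw [h.core_of_mem_M hbM] at hy
    rw [h.core_of_mem_M hdM] at hz
    rw [h.core_of_mem_M hgM] at hv
    refine h.not_triangle_of_subset_M (S := {b, d, g}) (f := {y, z, v}) ?_ ?_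
      (SimpleGraph.is3Clique_triple_iff.2 ⟨hyz, hyv, hzw⟩)
    · intro s hs
      simp only [mem_insert, mem_singleton] at hs
      rcases hs with rfl | rfl | rfl <;> assumption
    · intro k hk
      simp only [mem_insert, mem_singleton, mem_biUnion] at hk ⊢
      rcases hk with rfl | rfl | rfl
      · exact ⟨b, by simp, hy⟩
      · exact ⟨d, by simp, hz⟩
      · exact ⟨g, by simp, hv⟩

theorem colorable_two (h : IsCriticalTiling H T M I T₁ c)
    (hE : 2 * (T₁ ∪ M).card * (T₁ ∪ M).card + 4 * (T₁.card * (T₁ ∪ M).card) + 4 ≤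
      adjCount H (coreVerts M T₁ c) (coreVerts M T₁ c) +
      2 * adjCount H (T₁.image c) (coreVerts M T₁ c) + 2 * (T₁ ∪ M).card)
    (hM : 50 ≤ M.card) (hpM : T₁.card + 4 < 2 * M.card) :
    (H.induce (coreVerts M T₁ c : Set (Fin n))).Colorable 2 := by
  have hA : 2 * (T₁ ∪ M).card * (T₁ ∪ M).card + 4 ≤
      adjCount H (coreVerts M T₁ c) (coreVerts M T₁ c) + 2 * (T₁ ∪ M).card := by
    simpa using h.le_sum_nbrCount_crit hE (B := ∅) (by simp)
  have hq : 50 ≤ (T₁ ∪ M).card := hM.trans (card_le_card subset_union_right)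
  obtain ⟨s, hs, hlt⟩ : ∃ s ∈ T₁ ∪ M, 2 * (T₁ ∪ M).card - 2 <
      adjCount H (core T₁ c s) (coreVerts M T₁ c) := by
    apply exists_lt_of_sum_lt
    have : ∑ s ∈ T₁ ∪ M, adjCount H (core T₁ c s) (coreVerts M T₁ c) =
        adjCount H (coreVerts M T₁ c) (coreVerts M T₁ c) :=
      (sum_biUnion fun _ hs _ hs' hne => h.disjoint_core hs hs' hne).symm
    rw [this, sum_const, smul_eq_mul]
    obtain ⟨k, hk⟩ := Nat.exists_eq_add_of_le hq
    rw [hk] at hA ⊢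
    have : 2 * (50 + k) - 2 = 98 + 2 * k := by omega
    rw [this]
    nlinarith
  have hcl := h.isNClique_core hs
  obtain ⟨a, b, hab, hcore⟩ := card_eq_two.1 hcl.card_eq
  have hsub : core T₁ c s ⊆ coreVerts M T₁ c := subset_biUnion_of_mem _ hs
  have ha : a ∈ core T₁ c s := by simp [hcore]
  have hb : b ∈ core T₁ c s := by simp [hcore]
  rw [hcore, adjCount, sum_pair hab] at hlt
  exact colorable_two_of_triangle_free (hsub ha) (hsub hb) (hcl.isClique ha hb hab)
    h.card_coreVerts (fun f hf => h.not_triangle hE hM hpM hf) (by omega) hA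

end IsCriticalTiling

theorem HasKDisjointTriangles.mono {n : ℕ} {H : SimpleGraph (Fin n)} {j k : ℕ}
    (h : HasKDisjointTriangles H k) (hjk : j ≤ k) : HasKDisjointTriangles H j := by
  obtain ⟨T, rfl, htri, hdisj⟩ := h
  obtain ⟨U, hU, rfl⟩ := exists_subset_card_eq hjk
  exact ⟨U, rfl, fun s hs => htri s (hU hs), hdisj.mono hU⟩

theorem HasKDisjointTriangles.hasRainbowKTriangles {n : ℕ} {H : SimpleGraph (Fin n)}
    {χ : Sym2 (Fin n) → ℕ} {k : ℕ} (h : HasKDisjointTriangles H k)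
    (hχ : Set.InjOn χ H.edgeSet) : HasRainbowKTriangles (⊤ : SimpleGraph (Fin n)) χ k := by
  obtain ⟨T, hT, htri, hdisj⟩ := h
  refine ⟨T, hT, fun s hs => (htri s hs).mono le_top, hdisj, hχ.mono ?_⟩
  rintro e ⟨hdiag, s, hs, he⟩
  induction e using Sym2.ind with
  | _ x y =>
    exact (htri s hs).isClique (he x (by simp)) (he y (by simp)) fun hxy => hdiag (by simpa)

/-- A family of disjoint triangles extends to a tiling triple. -/
theorem exists_isTilingTriple {n : ℕ} {H : SimpleGraph (Fin n)} {F : Finset (Finset (Fin n))}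
    (hF : ∀ s ∈ F, H.IsNClique 3 s)
    (hFd : (F : Set (Finset (Fin n))).Pairwise fun s₁ s₂ => Disjoint s₁ s₂) :
    ∃ M I, IsTilingTriple H F M I := by
  classical
  obtain ⟨M, hM, hmax⟩ := (univ.filter fun M : Finset (Finset (Fin n)) =>
    (∀ e ∈ M, H.IsNClique 2 e) ∧ ((F ∪ M : Finset (Finset (Fin n))) :
      Set (Finset (Fin n))).Pairwise fun s₁ s₂ => Disjoint s₁ s₂).exists_max_image card
    ⟨∅, by simpa using hFd⟩
  simp only [mem_filter, mem_univ, true_and] at hM hmax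
  refine ⟨M, ((F ∪ M).biUnion id)ᶜ, hF, hM.1, ?_, hM.2, disjoint_compl_right,
    union_compl _⟩
  intro x hx y hy hxy
  have hnot : ∀ s ∈ F ∪ M, Disjoint {x, y} s := by
    intro s hs
    rw [disjoint_left]
    intro v hv hvs
    have hv' : v ∈ (F ∪ M).biUnion id := mem_biUnion.2 ⟨s, hs, hvs⟩
    rw [mem_insert, mem_singleton] at hv
    rcases hv with rfl | rfl
    · exact mem_compl.1 hx hv'
    · exact mem_compl.1 hy hv'
  have hnew : ({x, y} : Finset (Fin n)) ∉ M := by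
    intro he
    have := hnot _ (mem_union_right _ he)
    simp at this
  have := hmax (insert {x, y} M) ⟨?_, ?_⟩
  · rw [card_insert_of_notMem hnew] at this
    omega
  · intro e he
    rcases mem_insert.1 he with rfl | he
    · refine ⟨?_, card_pair hxy.ne⟩
      rw [coe_pair, SimpleGraph.isClique_pair]
      exact fun _ => hxy
    · exact hM.1 e he
  · rw [union_insert, coe_insert]
    exact Set.pairwise_insert.2 ⟨hM.2, fun s hs _ => ⟨hnot s hs, (hnot s hs).symm⟩⟩

theorem IsMaxTilingTriple.le_card {n : ℕ} {H : SimpleGraph (Fin n)}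
    {T M : Finset (Finset (Fin n))} {I : Finset (Fin n)} (h : IsMaxTilingTriple H T M I) {k : ℕ}
    (hk : HasKDisjointTriangles H k) : k ≤ T.card := by
  obtain ⟨F, rfl, hF, hFd⟩ := hk
  obtain ⟨M', I', h'⟩ := exists_isTilingTriple hF hFd
  rcases h.2 F M' I' h' with h1 | h1
  · exact h1.le
  · exact h1.1.le

theorem IsOptimalTiling.eq_of_seesAt {n : ℕ} {H : SimpleGraph (Fin n)}
    {T M : Finset (Finset (Fin n))} (h : IsOptimalTiling H T M) {s e e' : Finset (Fin n)}
    (hs : s ∈ T) (he : e ∈ M) (he' : e' ∈ M) (hne : e ≠ e') {w w' : Fin n}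
    (hw : seesAt H e s w) (hw' : seesAt H e' s w') : w = w' := by
  classical
  by_contra hww
  have hM : ∀ {e}, e ∈ M → Disjoint s e := fun {e} he =>
    h.disj (mem_union_left _ hs) (mem_union_right _ he) fun h' =>
      disjoint_left.1 h.disjoint_families hs (h' ▸ he)
  have hd : Disjoint (insert w e) (insert w' e') := by
    rw [disjoint_insert_left, disjoint_insert_right, mem_insert, not_or]
    exact ⟨⟨hww, disjoint_left.1 (hM he') hw.1⟩, fun h' => disjoint_left.1 (hM he) hw'.1 h',
      h.disj (mem_union_right _ he) (mem_union_right _ he') hne⟩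
  have hF1 := (h.edge e he).insert fun b hb => (hw.2 b hb).symm
  have hF2 := (h.edge e' he').insert fun b hb => (hw'.2 b hb).symm
  have hFne : insert w e ≠ insert w' e' := by
    intro h'
    rw [h', disjoint_self] at hd
    simp at hd
  have hother : ∀ s' ∈ T ∪ M, s' ≠ s → s' ≠ e → s' ≠ e' →
      ∀ f ∈ ({insert w e, insert w' e'} : Finset (Finset (Fin n))), Disjoint s' f := by
    intro s' hs' h1 h2 h3 f hf
    rw [mem_insert, mem_singleton] at hf
    have hds := h.disj hs' (mem_union_left _ hs) h1
    rcases hf with rfl | rfl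
    · rw [disjoint_insert_right]
      exact ⟨fun h' => disjoint_left.1 hds h' hw.1, h.disj hs' (mem_union_right _ he) h2⟩
    · rw [disjoint_insert_right]
      exact ⟨fun h' => disjoint_left.1 hds h' hw'.1, h.disj hs' (mem_union_right _ he') h3⟩
  have := h.exchange (fun _ => w) (F := {insert w e, insert w' e'}) (τ := {s}) (J := ∅)
    (μ := {e, e'}) ?_ ?_ (by simpa) (by simp) (by simp) ?_ ?_ (by simp)
  · rw [card_pair hFne] at this
    simp at this
  · intro f hf
    rw [mem_insert, mem_singleton] at hf
    rcases hf with rfl | rfl <;> assumption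
  · intro f hf g hg hfg
    rw [mem_insert, mem_singleton] at hf hg
    rcases hf with rfl | rfl <;> rcases hg with rfl | rfl
    · exact absurd rfl hfg
    · exact hd
    · exact hd.symm
    · exact absurd rfl hfg
  · intro s' hs' hs's
    have hnM := disjoint_left.1 h.disjoint_families hs'
    exact hother s' (mem_union_left _ hs') (by simpa using hs's) (fun h' => hnM (h' ▸ he))
      fun h' => hnM (h' ▸ he')
  · intro e'' he'' hμ
    rw [mem_insert, mem_singleton, not_or] at hμ
    exact hother e'' (mem_union_right _ he'')
      (fun h' => disjoint_left.1 h.disjoint_families hs (h' ▸ he'')) hμ.1 hμ.2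

theorem IsOptimalTiling.exists_crit {n : ℕ} {H : SimpleGraph (Fin n)}
    {T M : Finset (Finset (Fin n))} (h : IsOptimalTiling H T M) {s : Finset (Fin n)} (hs : s ∈ T)
    (hsee : ∃ e₁ ∈ M, ∃ e₂ ∈ M, e₁ ≠ e₂ ∧ sees H e₁ s ∧ sees H e₂ s) :
    ∃ x ∈ s, ∃ e₁ ∈ M, ∃ e₂ ∈ M, e₁ ≠ e₂ ∧ seesAt H e₁ s x ∧ seesAt H e₂ s x := by
  obtain ⟨e₁, he₁, e₂, he₂, hne, ⟨w₁, hw₁⟩, w₂, hw₂⟩ := hsee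
  obtain rfl := h.eq_of_seesAt hs he₁ he₂ hne hw₁ hw₂
  exact ⟨w₁, hw₁.1, e₁, he₁, e₂, he₂, hne, hw₁, hw₂⟩

theorem card_bounds {n t p m r : ℕ} (hn : 1000000 ≤ n) (ht : (t : ℝ) ≤ (2 * n - 6) / 9 + 1)
    (hp : p ≤ t + 1) (hm : ((n : ℝ) - 3 * (t + 1)) / 2 - Real.sqrt (2 * n) / 2 < m)
    (hr : (r : ℝ) < Real.sqrt (2 * n)) : 2 * r + 50 ≤ m ∧ p + 4 < 2 * m := by
  have hn' : (1000000 : ℝ) ≤ n := by exact_mod_cast hn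
  have hp' : (p : ℝ) ≤ t + 1 := by exact_mod_cast hp
  have hs : Real.sqrt (2 * n) ≤ n / 100 := by
    rw [Real.sqrt_le_left (by positivity)]
    nlinarith
  constructor
  · have : (2 * r + 50 : ℝ) ≤ m := by linarith
    exact_mod_cast this
  · have : (p + 4 : ℝ) < 2 * m := by linarith
    exact_mod_cast this

/-- Claims 4.10/4.12. Under the stability conclusions, letting `V'`
be the set of non-critical vertices of the triangles of `T₁`, the subgraph of `H`
induced by `V(M) ∪ V'` is bipartite (i.e. 2-colorable). -/
theorem statement18 (δ : ℝ) (hδ : 0 < δ) :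
    ∃ N₀ : ℕ, ∀ n : ℕ, N₀ ≤ n → ∀ t : ℕ,
      δ * n ≤ t → (t : ℝ) ≤ (2 * n - 6) / 9 + 1 →
      ∀ χ : Sym2 (Fin n) → ℕ,
        IsSurjColoring n (exTriangles n (t + 1) + 2) χ →
        ¬ HasRainbowKTriangles (⊤ : SimpleGraph (Fin n)) χ (t + 2) →
        ∀ H : SimpleGraph (Fin n), IsRepGraph χ (exTriangles n (t + 1) + 2) H →
        ∀ (T M : Finset (Finset (Fin n))) (I : Finset (Fin n)),
          IsMaxTilingTriple H T M I →
          ∀ T₁ T₂ T₃ T₄ : Finset (Finset (Fin n)),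
            IsIdealPartition H T M I T₁ T₂ T₃ T₄ →
            (t - 1 ≤ T₁.card ∧ T₁.card ≤ t + 1) →
            (((n : ℝ) - 3 * (t + 1)) / 2 - Real.sqrt (2 * n) / 2 < M.card ∧
              (M.card : ℝ) ≤ ((n : ℝ) - 3 * (t + 1)) / 2) →
            (I.card : ℝ) < Real.sqrt (2 * n) →
            (H.induce ((↑(M.biUnion id) : Set (Fin n)) ∪
              nonCriticalVerts H M T₁)).Colorable 2 := by
  refine ⟨1000000, ?_⟩
  intro n hn t _ ht χ _ hrain H hH T M I hmax T₁ T₂ T₃ T₄ hideal hT₁ hM hI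
  have hTM := hmax.1
  have hTcard : T.card = t + 1 := by
    apply le_antisymm
    · by_contra! hlt
      have : HasKDisjointTriangles H T.card :=
        ⟨T, rfl, hTM.1, hTM.2.2.2.1.mono (coe_subset.2 subset_union_left)⟩
      exact hrain ((this.mono hlt).hasRainbowKTriangles hH.2)
    · refine hmax.le_card ?_
      by_contra hno
      have := ncard_edgeSet_le_exTriangles hno
      have := hH.1
      omega
  have hopt : IsOptimalTiling H T M :=
    ⟨hTM.1, hTM.2.1, hTM.2.2.2.1, fun h => by simpa using hmax.le_card h⟩
  have hT₁iff := hideal.2.2.2.2.2.2.2.1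
  have hsub : T₁ ⊆ T := fun s hs => ((hT₁iff s).1 hs).1
  have hcrit : ∀ s : Finset (Fin n), ∃ x, s ∈ T₁ → x ∈ s ∧ ∃ e₁ ∈ M, ∃ e₂ ∈ M, e₁ ≠ e₂ ∧
      seesAt H e₁ s x ∧ seesAt H e₂ s x := by
    intro s
    by_cases hs : s ∈ T₁
    · obtain ⟨x, hx⟩ := hopt.exists_crit (hsub hs) ((hT₁iff s).1 hs).2
      exact ⟨x, fun _ => hx⟩
    · exact ⟨⟨0, by omega⟩, fun h => absurd h hs⟩
  choose c hc using hcrit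
  have h : IsCriticalTiling H T M I T₁ c :=
    { toIsOptimalTiling := hopt
      indep := hTM.2.2.1
      disjI := hTM.2.2.2.2.1
      cover := hTM.2.2.2.2.2
      sub := hsub
      crit_mem := fun s hs => (hc s hs).1
      two_le := by
        intro s hs
        obtain ⟨-, e₁, he₁, e₂, he₂, hne, h₁, h₂⟩ := hc s hs
        exact one_lt_card.2 ⟨e₁, mem_seers.2 ⟨he₁, h₁⟩, e₂, mem_seers.2 ⟨he₂, h₂⟩, hne⟩ }
  obtain ⟨hIM, hpM⟩ := card_bounds hn ht hT₁.2 hM.1 hI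
  have hE := h.le_adjCount_coreVerts (t := t) (fun d hd e he e' he' hed hed' => by
      rw [mem_sdiff] at hd
      by_contra hne
      exact hd.2 ((hT₁iff d).2 ⟨hd.1, e, he, e', he', hne, hed, hed'⟩)) hTcard
    (by rw [card_sdiff_of_subset hsub]; omega) hIM hH.1
  refine SimpleGraph.Colorable.of_hom
    (SimpleGraph.Embedding.toHom (SimpleGraph.induceHomOfLE H ?_))
    (h.colorable_two hE (by omega) hpM)
  rintro v (hv | ⟨s, hs, x, hx, hvs, hvx⟩)
  · obtain ⟨e, he, hve⟩ := mem_biUnion.1 hv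
    refine mem_biUnion.2 ⟨e, mem_union_right _ he, ?_⟩
    rwa [h.core_of_mem_M he]
  · obtain ⟨-, e₁, he₁, -, -, -, h₁, -⟩ := hc s hs
    refine mem_biUnion.2 ⟨s, mem_union_left _ hs, ?_⟩
    rw [IsCriticalTiling.core_of_mem hs, hx.2.2 e₁ he₁ (c s) h₁]
    exact mem_erase.2 ⟨hvx, hvs⟩
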